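/- arXiv:math/0312390 — 4 statements merged into one kernel-verified Lean document; each statement's English description precedes it below -/
import Mathlib

section
/- Let G be a chordal graph on n vertices and A a partial Hermitian matrix with graph G. Then there exists a Hermitian completion M of A such that i₋(M) + i₀(M) equals the maximum over all maximal cliques K of G of i₋(A(K)) + i₀(A(K)). -/
open Matrix ComplexOrder

/-- Number of positive eigenvalues (with multiplicity) of a Hermitian matrix. -/
noncomputable def posCount {m : Type*} [Fintype m] [DecidableEq m]
    {M : Matrix m m ℂ} (hM : M.IsHermitian) : ℕ :=
  Fintype.card {i // 0 < hM.eigenvalues i}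

/-- Number of negative eigenvalues (with multiplicity) of a Hermitian matrix. -/
noncomputable def negCount {m : Type*} [Fintype m] [DecidableEq m]
    {M : Matrix m m ℂ} (hM : M.IsHermitian) : ℕ :=
  Fintype.card {i // hM.eigenvalues i < 0}

/-- Number of zero eigenvalues (with multiplicity) of a Hermitian matrix. -/
noncomputable def zeroCount {m : Type*} [Fintype m] [DecidableEq m]
    {M : Matrix m m ℂ} (hM : M.IsHermitian) : ℕ :=
  Fintype.card {i // hM.eigenvalues i = 0}

/-- `A` is a partial Hermitian matrix with graph `G`: the diagonal is real and the
specified (edge) entries are conjugate symmetric.  Non-edge entries of the array `A`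
are regarded as unspecified. -/
def IsPartialHermitian {n : ℕ} (G : SimpleGraph (Fin n)) (A : Matrix (Fin n) (Fin n) ℂ) : Prop :=
  (∀ i : Fin n, (A i i).im = 0) ∧ ∀ i j : Fin n, G.Adj i j → A j i = star (A i j)

/-- The principal submatrix of `A` indexed by `K`. -/
def cliqueSub {n : ℕ} (A : Matrix (Fin n) (Fin n) ℂ) (K : Finset (Fin n)) :
    Matrix K K ℂ :=
  A.submatrix (fun i => (i : Fin n)) (fun j => (j : Fin n))

/-- `A` is a partial positive matrix with graph `G`: it is partial Hermitian and every
fully specified principal submatrix `A(K)`, `K` a clique of `G`, is positive definite. -/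
def IsPartialPositive {n : ℕ} (G : SimpleGraph (Fin n)) (A : Matrix (Fin n) (Fin n) ℂ) : Prop :=
  IsPartialHermitian G A ∧
    ∀ K : Finset (Fin n), G.IsClique (K : Set (Fin n)) → (cliqueSub A K).PosDef

/-- The completion number of `G` is `c`: `c` is the least `k` such that every partial
positive matrix with graph `G` has a Hermitian completion with at most `k` negative
eigenvalues. -/
def CompletionNumberIs {n : ℕ} (G : SimpleGraph (Fin n)) (c : ℕ) : Prop :=
  IsLeast {k : ℕ | ∀ A : Matrix (Fin n) (Fin n) ℂ, IsPartialPositive G A →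
    ∃ M : Matrix (Fin n) (Fin n) ℂ, ∃ hM : M.IsHermitian,
      (∀ i j : Fin n, (i = j ∨ G.Adj i j) → M i j = A i j) ∧ negCount hM ≤ k} c

/-- A closed walk has a chord: an edge of `G` between two vertices of the walk that is
not an edge of the walk. -/
def HasChord {V : Type*} {G : SimpleGraph V} {v : V} (w : G.Walk v v) : Prop :=
  ∃ x y : V, x ∈ w.support ∧ y ∈ w.support ∧ G.Adj x y ∧ s(x, y) ∉ w.edges

/-- A graph is chordal if every cycle of length at least 4 has a chord. -/
def IsChordal {V : Type*} (G : SimpleGraph V) : Prop :=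
  ∀ ⦃v : V⦄ (w : G.Walk v v), w.IsCycle → 4 ≤ w.length → HasChord w

/-- `K` is a maximal clique of `G`. -/
def IsMaxClique {n : ℕ} (G : SimpleGraph (Fin n)) (K : Finset (Fin n)) : Prop :=
  G.IsClique (K : Set (Fin n)) ∧
    ∀ K' : Finset (Fin n), G.IsClique (K' : Set (Fin n)) → K ⊆ K' → K' = K

section
open SimpleGraph

theorem geo_edge {V : Type*} {G : SimpleGraph V} {x y : V} (w : G.Walk x y) :
    (∀ q : G.Walk x y, w.length ≤ q.length) →
    ∀ a b : V, a ∈ w.support → b ∈ w.support → G.Adj a b → s(a, b) ∈ w.edges := by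
  classical
  induction w with
  | nil =>
    intro _ a b ha hb hab
    simp at ha hb
    subst ha; subst hb
    exact absurd hab (G.loopless.irrefl _)
  | @cons u v y h p ih =>
    intro hmin a b ha hb hab
    have hp : ∀ q : G.Walk v y, p.length ≤ q.length := by
      intro q
      have := hmin (Walk.cons h q)
      simpa using this
    have key : ∀ c, c ∈ p.support → G.Adj u c → c = v := by
      intro c hc huc
      have h1 := hmin (Walk.cons huc (p.dropUntil c hc))
      have h2 := congrArg Walk.length (p.take_spec hc)
      rw [Walk.length_append] at h2
      simp only [Walk.length_cons] at h1
      have h3 : (p.takeUntil c hc).length = 0 := by omega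
      exact (Walk.eq_of_length_eq_zero h3).symm
    rw [Walk.support_cons, List.mem_cons] at ha hb
    rw [Walk.edges_cons, List.mem_cons]
    rcases ha with rfl | ha
    · rcases hb with rfl | hb
      · exact absurd hab (G.loopless.irrefl _)
      · left; rw [key b hb hab]
    · rcases hb with rfl | hb
      · left; rw [key a ha hab.symm, Sym2.eq_swap]
      · right; exact ih hp a b ha hb hab

theorem chordal_sep {V : Type*} {G : SimpleGraph V} (hG : IsChordal G) (H : Set V) (v x y : V)
    (hv : v ∉ H) (hvH : ∀ h ∈ H, ¬ G.Adj v h) (hx : G.Adj v x) (hy : G.Adj v y) (hxy : x ≠ y)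
    (G' : SimpleGraph V)
    (hG' : ∀ a b, G'.Adj a b ↔ G.Adj a b ∧ (a ∈ H ∨ a = x ∨ a = y) ∧ (b ∈ H ∨ b = x ∨ b = y))
    (hr : G'.Reachable x y) : G.Adj x y := by
  classical
  by_contra hna
  obtain ⟨w, hw⟩ := hr.exists_walk_length_eq_dist
  have hmin : ∀ q : G'.Walk x y, w.length ≤ q.length := fun q => hw ▸ dist_le q
  have hpath : w.IsPath := w.isPath_of_length_eq_dist hw
  have hle : G' ≤ G := fun a b h => ((hG' a b).1 h).1
  have hsup : ∀ a ∈ w.support, a ∈ H ∨ a = x ∨ a = y := by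
    have : ∀ (c d : V) (q : G'.Walk c d), (c ∈ H ∨ c = x ∨ c = y) →
        ∀ a ∈ q.support, a ∈ H ∨ a = x ∨ a = y := by
      intro c d q
      induction q with
      | nil => intro hc a ha; simp at ha; exact ha ▸ hc
      | cons h p ih =>
        intro hc a ha
        rw [Walk.support_cons, List.mem_cons] at ha
        rcases ha with rfl | ha
        · exact hc
        · exact ih ((hG' _ _).1 h).2.2 a ha
    exact this x y w (by simp)
  have hvw : v ∉ w.support := by
    intro h
    rcases hsup v h with h | h | h
    · exact hv h
    · exact hx.ne h
    · exact hy.ne h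
  have hlen : 2 ≤ w.length := by
    by_contra hl
    have : w.length = 0 ∨ w.length = 1 := by omega
    rcases this with h | h
    · exact hxy (Walk.eq_of_length_eq_zero h)
    · exact hna (hle (Walk.adj_of_length_eq_one h))
  set p : G.Walk x y := w.mapLe hle with hp
  have hpp : p.IsPath := (Walk.isPath_mapLe hle).2 hpath
  have hps : p.support = w.support := by simp [hp]
  have hpe : p.edges = w.edges := by simp [hp]
  have hpl : p.length = w.length := by simp [hp, Walk.mapLe]
  let c : G.Walk v v := Walk.cons hx (p.concat hy.symm)
  have hc : c.IsCycle := by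
    rw [Walk.cons_isCycle_iff]
    refine ⟨?_, ?_⟩
    · rw [Walk.concat_isPath_iff]
      exact ⟨hpp, by rw [hps]; exact hvw⟩
    · rw [Walk.edges_concat]
      simp only [List.concat_eq_append, List.mem_append, List.mem_singleton, not_or]
      refine ⟨fun h => hvw (hps ▸ p.fst_mem_support_of_mem_edges h), ?_⟩
      intro h
      rw [Sym2.eq_swap, Sym2.eq_iff] at h
      rcases h with h | h
      · exact hxy h.1
      · exact hy.ne h.2
  have hcl : 4 ≤ c.length := by simp [c, hpl]; omega
  obtain ⟨a, b, ha, hb, hab, hne⟩ := hG c hc hcl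
  have hcs : ∀ z, z ∈ c.support → z = v ∨ z ∈ w.support := by
    intro z hz
    simp [c, Walk.support_concat, hps] at hz
    tauto
  have hce : ∀ e, e ∈ c.edges ↔ e = s(v, x) ∨ e ∈ w.edges ∨ e = s(y, v) := by
    intro e
    simp [c, Walk.edges_concat, hpe]
  have key : ∀ z, z ∈ w.support → G.Adj v z → s(v, z) ∈ c.edges := by
    intro z hz hvz
    rw [hce]
    rcases hsup z hz with h | h | h
    · exact absurd hvz (hvH z h)
    · left; rw [h]
    · right; right; rw [h, Sym2.eq_swap]
  rcases hcs a ha with hav | ha'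
  · subst hav
    rcases hcs b hb with hbv | hb
    · subst hbv; exact G.loopless.irrefl _ hab
    · exact hne (key b hb hab)
  · rcases hcs b hb with hbv | hb
    · subst hbv; exact hne (Sym2.eq_swap ▸ key a ha' hab.symm)
    · apply hne
      rw [hce]
      right; left
      exact geo_edge w hmin a b ha' hb ((hG' a b).2 ⟨hab, hsup a ha', hsup b hb⟩)

theorem exists_simp {V : Type*} [DecidableEq V] {G : SimpleGraph V} (hG : IsChordal G) (m : ℕ) :
    ∀ (U : Finset V), U.card ≤ m → ∀ v ∈ U, (∃ u ∈ U, u ≠ v ∧ ¬ G.Adj v u) →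
    ∃ w ∈ U, w ≠ v ∧ ¬ G.Adj v w ∧
      ∀ a ∈ U, ∀ b ∈ U, G.Adj w a → G.Adj w b → a ≠ b → G.Adj a b := by
  classical
  induction m with
  | zero =>
    intro U hU v hv
    have := Finset.card_pos.2 ⟨v, hv⟩
    omega
  | succ m ih =>
    intro U hU v hv ⟨u, huU, huv, hvu⟩
    let R : V → V → Prop := fun a b => G.Adj a b ∧ b ∈ U ∧ b ≠ v ∧ ¬ G.Adj v b
    let H : Set V := {h | Relation.ReflTransGen R u h}
    have hH : ∀ h ∈ H, h ∈ U ∧ h ≠ v ∧ ¬ G.Adj v h := by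
      intro h hh
      induction hh with
      | refl => exact ⟨huU, huv, hvu⟩
      | tail _ h2 _ => exact h2.2
    have hcl : ∀ h ∈ H, ∀ s ∈ U, G.Adj h s → s ∉ H → G.Adj v s := by
      intro h hh s hs hhs hsH
      by_contra hcon
      apply hsH
      refine Relation.ReflTransGen.tail hh ⟨hhs, hs, ?_, hcon⟩
      rintro rfl
      exact (hH h hh).2.2 hhs.symm
    have huH : u ∈ H := Relation.ReflTransGen.refl
    let S : Set V := {s | s ∈ U ∧ s ∉ H ∧ ∃ h ∈ H, G.Adj h s}
    have hSv : ∀ s ∈ S, G.Adj v s := fun s ⟨h1, h2, h, h3, h4⟩ => hcl h h3 s h1 h4 h2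
    have hS : ∀ x ∈ S, ∀ y ∈ S, x ≠ y → G.Adj x y := by
      intro x hx y hy hxy
      let G' : SimpleGraph V :=
        { Adj := fun a b => G.Adj a b ∧ (a ∈ H ∨ a = x ∨ a = y) ∧ (b ∈ H ∨ b = x ∨ b = y)
          symm := ⟨fun a b h => ⟨h.1.symm, h.2.2, h.2.1⟩⟩
          loopless := ⟨fun a h => G.loopless.irrefl a h.1⟩ }
      have hu : ∀ h ∈ H, G'.Reachable u h := by
        intro h hh
        induction hh with
        | refl => exact Reachable.refl _
        | @tail b c h1 h2 h3 =>
          refine h3.trans (Adj.reachable ?_)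
          exact ⟨h2.1, Or.inl h1, Or.inl (Relation.ReflTransGen.tail h1 h2)⟩
      obtain ⟨_, _, h1, h1H, h1x⟩ := id hx
      obtain ⟨_, _, h2, h2H, h2y⟩ := id hy
      refine chordal_sep hG H v x y (fun h => (hH v h).2.1 rfl) (fun h hh => (hH h hh).2.2)
        (hSv x hx) (hSv y hy) hxy G' (fun _ _ => Iff.rfl) ?_
      have e1 : G'.Adj h1 x := ⟨h1x, Or.inl h1H, Or.inr (Or.inl rfl)⟩
      have e2 : G'.Adj h2 y := ⟨h2y, Or.inl h2H, Or.inr (Or.inr rfl)⟩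
      exact (((hu h1 h1H).trans e1.reachable).symm).trans ((hu h2 h2H).trans e2.reachable)
    let T : Finset V := U.filter (fun a => a ∈ H ∨ a ∈ S)
    have hT : ∀ a, a ∈ T ↔ a ∈ H ∨ a ∈ S := by
      intro a
      simp only [T, Finset.mem_filter, and_iff_right_iff_imp]
      rintro (h | h)
      · exact (hH a h).1
      · exact h.1
    have hvT : v ∉ T := by
      rw [hT]
      rintro (h | h)
      · exact (hH v h).2.1 rfl
      · exact G.loopless.irrefl v (hSv v h)
    have hTc : T.card ≤ m := by
      have : T.card < U.card := Finset.card_lt_card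
        (Finset.ssubset_iff_of_subset (Finset.filter_subset _ _) |>.2 ⟨v, hv, hvT⟩)
      omega
    have fin : ∀ w ∈ H, (∀ a ∈ T, ∀ b ∈ T, G.Adj w a → G.Adj w b → a ≠ b → G.Adj a b) →
        ∃ w ∈ U, w ≠ v ∧ ¬ G.Adj v w ∧
        ∀ a ∈ U, ∀ b ∈ U, G.Adj w a → G.Adj w b → a ≠ b → G.Adj a b := by
      intro w hw h
      refine ⟨w, (hH w hw).1, (hH w hw).2.1, (hH w hw).2.2, ?_⟩
      have : ∀ a ∈ U, G.Adj w a → a ∈ T := by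
        intro a ha hwa
        rw [hT]
        by_cases haH : a ∈ H
        · exact Or.inl haH
        · exact Or.inr ⟨ha, haH, w, hw, hwa⟩
      intro a ha b hb hwa hwb
      exact h a (this a ha hwa) b (this b hb hwb) hwa hwb
    have use : ∀ z ∈ T, (∀ s ∈ S, s ≠ z → G.Adj z s) → (∃ t ∈ T, t ≠ z ∧ ¬ G.Adj z t) →
        ∃ w ∈ H, (∀ a ∈ T, ∀ b ∈ T, G.Adj w a → G.Adj w b → a ≠ b → G.Adj a b) := by
      intro z hz hzS hzt
      obtain ⟨w, hwT, hwz, hzw, h⟩ := ih T hTc z hz hzt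
      refine ⟨w, ?_, h⟩
      rcases (hT w).1 hwT with h | h
      · exact h
      · exact absurd (hzS w h hwz) hzw
    by_cases h1 : ∃ z ∈ S, ∃ t ∈ T, t ≠ z ∧ ¬ G.Adj z t
    · obtain ⟨z, hz, ht⟩ := h1
      obtain ⟨w, hw, h⟩ := use z ((hT z).2 (Or.inr hz)) (fun s hs hsz => hS z hz s hs hsz.symm) ht
      exact fin w hw h
    · push Not at h1
      by_cases h2 : ∃ z ∈ H, ∃ t ∈ T, t ≠ z ∧ ¬ G.Adj z t
      · obtain ⟨z, hz, ht⟩ := h2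
        have hzT := (hT z).2 (Or.inl hz)
        obtain ⟨w, hw, h⟩ := use z hzT (fun s hs hsz => (h1 s hs z hzT hsz.symm).symm) ht
        exact fin w hw h
      · push Not at h2
        refine fin u huH ?_
        intro a ha b hb _ _ hab
        rcases (hT a).1 ha with h | h
        · exact h2 a h b hb hab.symm
        · exact h1 a h b hb hab.symm

theorem exists_simplicial {V : Type*} [DecidableEq V] {G : SimpleGraph V} (hG : IsChordal G)
    (U : Finset V) (hU : U.Nonempty) :
    ∃ w ∈ U, ∀ a ∈ U, ∀ b ∈ U, G.Adj w a → G.Adj w b → a ≠ b → G.Adj a b := by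
  by_cases h : ∃ v ∈ U, ∃ u ∈ U, u ≠ v ∧ ¬ G.Adj v u
  · obtain ⟨v, hv, hu⟩ := h
    obtain ⟨w, hw, _, _, h⟩ := exists_simp hG _ U le_rfl v hv hu
    exact ⟨w, hw, h⟩
  · push Not at h
    obtain ⟨w, hw⟩ := hU
    exact ⟨w, hw, fun a ha b hb _ _ hab => h a ha b hb hab.symm⟩

end

/-- Vectors supported on `U`. -/
def suppOn {ι : Type*} (U : Finset ι) : Submodule ℂ (ι → ℂ) where
  carrier := {x | ∀ i, i ∉ U → x i = 0}
  add_mem' := by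
    intro a b ha hb i hi
    simp [ha i hi, hb i hi]
  zero_mem' := by intro i _; rfl
  smul_mem' := by
    intro c x hx i hi
    simp [hx i hi]

theorem mem_suppOn {ι : Type*} {U : Finset ι} {x : ι → ℂ} :
    x ∈ suppOn U ↔ ∀ i, i ∉ U → x i = 0 := Iff.rfl

theorem suppOn_mono {ι : Type*} {U T : Finset ι} (h : U ⊆ T) : suppOn U ≤ suppOn T :=
  fun _ hx i hi => hx i (fun h' => hi (h h'))

theorem finrank_suppOn {ι : Type*} [Fintype ι] [DecidableEq ι] (U : Finset ι) :
    Module.finrank ℂ (suppOn U) = U.card := by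
  have e : suppOn U ≃ₗ[ℂ] (U → ℂ) :=
    { toFun := fun x i => x.1 i
      map_add' := fun _ _ => rfl
      map_smul' := fun _ _ => rfl
      invFun := fun z => ⟨fun i => if h : i ∈ U then z ⟨i, h⟩ else 0, fun i hi => by simp [hi]⟩
      left_inv := by
        intro x
        ext i
        by_cases h : i ∈ U
        · simp [h]
        · simp [h, x.2 i h]
      right_inv := by
        intro z
        ext i
        simp }
  rw [e.finrank_eq]
  simp

theorem finrank_le_of_disj {ι : Type*} [Fintype ι] [DecidableEq ι] (U : Finset ι)
    (P N : Submodule ℂ (ι → ℂ)) (hP : P ≤ suppOn U) (hN : N ≤ suppOn U)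
    (h : ∀ x ∈ P, x ∈ N → x = 0) :
    Module.finrank ℂ P + Module.finrank ℂ N ≤ U.card := by
  have h1 := Submodule.finrank_sup_add_finrank_inf_eq P N
  have h2 : P ⊓ N = ⊥ := by
    rw [eq_bot_iff]
    intro x hx
    simpa using h x hx.1 hx.2
  rw [h2, finrank_bot] at h1
  have h3 := Submodule.finrank_mono (sup_le hP hN)
  rw [finrank_suppOn] at h3
  omega

/-- sesquilinear form -/
noncomputable def bf {ι : Type*} [Fintype ι] (M : Matrix ι ι ℂ) (x y : ι → ℂ) : ℂ :=
  star x ⬝ᵥ (M *ᵥ y)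

/-- quadratic form -/
noncomputable def qf {ι : Type*} [Fintype ι] (M : Matrix ι ι ℂ) (x : ι → ℂ) : ℝ := (bf M x x).re

section
variable {ι : Type*} [Fintype ι]

theorem bf_add_left (M : Matrix ι ι ℂ) (x y z : ι → ℂ) : bf M (x + y) z = bf M x z + bf M y z := by
  simp [bf, add_dotProduct]
theorem bf_add_right (M : Matrix ι ι ℂ) (x y z : ι → ℂ) :
    bf M z (x + y) = bf M z x + bf M z y := by
  simp [bf, mulVec_add, dotProduct_add]

theorem bf_symm {M : Matrix ι ι ℂ} (hM : M.IsHermitian) (x y : ι → ℂ) :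
    bf M y x = star (bf M x y) := by
  unfold bf
  rw [star_dotProduct, star_mulVec, hM.eq, ← dotProduct_mulVec]

theorem qf_smul (M : Matrix ι ι ℂ) (c : ℂ) (x : ι → ℂ) :
    qf M (c • x) = Complex.normSq c * qf M x := by
  have : bf M (c • x) (c • x) = (Complex.normSq c : ℂ) * bf M x x := by
    simp only [bf, star_smul, mulVec_smul, dotProduct_smul, smul_dotProduct, smul_eq_mul]
    rw [Complex.normSq_eq_conj_mul_self]
    simp; ring
  rw [qf, this, Complex.re_ofReal_mul, qf]

theorem bf_congr {M M' : Matrix ι ι ℂ} {U : Finset ι} (h : ∀ i ∈ U, ∀ j ∈ U, M i j = M' i j)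
    {x y : ι → ℂ} (hx : x ∈ suppOn U) (hy : y ∈ suppOn U) : bf M x y = bf M' x y := by
  simp only [bf, dotProduct, mulVec]
  refine Finset.sum_congr rfl fun i _ => ?_
  by_cases hi : i ∈ U
  · congr 1
    refine Finset.sum_congr rfl fun j _ => ?_
    by_cases hj : j ∈ U
    · rw [h i hi j hj]
    · simp [hy j hj]
  · simp [hx i hi]

theorem qf_congr {M M' : Matrix ι ι ℂ} {U : Finset ι} (h : ∀ i ∈ U, ∀ j ∈ U, M i j = M' i j)
    {x : ι → ℂ} (hx : x ∈ suppOn U) : qf M x = qf M' x := by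
  rw [qf, bf_congr h hx hx, qf]

theorem bf_zero {M : Matrix ι ι ℂ} {U : Finset ι} {x t : ι → ℂ} (hx : x ∈ suppOn U)
    (ht : ∀ i ∈ U, (M *ᵥ t) i = 0) : bf M x t = 0 := by
  rw [bf, dotProduct]
  refine Finset.sum_eq_zero fun i _ => ?_
  by_cases hi : i ∈ U
  · simp [ht i hi]
  · simp [hx i hi]

theorem qf_add {M : Matrix ι ι ℂ} (hM : M.IsHermitian) {U : Finset ι} {x t : ι → ℂ}
    (hx : x ∈ suppOn U) (ht : ∀ i ∈ U, (M *ᵥ t) i = 0) : qf M (x + t) = qf M x + qf M t := by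
  have h1 := bf_zero hx ht
  have h2 : bf M t x = 0 := by rw [bf_symm hM, h1, star_zero]
  simp [qf, bf_add_left, bf_add_right, h1, h2]

theorem qf_zero (M : Matrix ι ι ℂ) : qf M 0 = 0 := by simp [qf, bf]

variable [DecidableEq ι]

theorem ext_sub {M : Matrix ι ι ℂ} (hM : M.IsHermitian) {U : Finset ι} {v : ι} (hv : v ∉ U)
    {t : ι → ℂ} (htv : t v = 1) (ht : t ∈ suppOn (insert v U)) (hMt : ∀ i ∈ U, (M *ᵥ t) i = 0)
    (σ : ℝ) (hq : 0 < σ * qf M t) (W : Submodule ℂ (ι → ℂ)) (hW : W ≤ suppOn U)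
    (hWp : ∀ x ∈ W, x ≠ 0 → 0 < σ * qf M x) :
    ∃ W' : Submodule ℂ (ι → ℂ), W' ≤ suppOn (insert v U) ∧
      (∀ x ∈ W', x ≠ 0 → 0 < σ * qf M x) ∧ Module.finrank ℂ W' = Module.finrank ℂ W + 1 := by
  refine ⟨W ⊔ Submodule.span ℂ {t}, ?_, ?_, ?_⟩
  · refine sup_le (hW.trans (suppOn_mono (Finset.subset_insert _ _))) ?_
    rw [Submodule.span_singleton_le_iff_mem]
    exact ht
  · intro x hx hx0
    obtain ⟨w, hw, z, hz, rfl⟩ := Submodule.mem_sup.1 hx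
    obtain ⟨c, rfl⟩ := Submodule.mem_span_singleton.1 hz
    rw [qf_add hM (hW hw) (by intro i hi; simp [mulVec_smul, hMt i hi]), qf_smul]
    by_cases hw0 : w = 0
    · subst hw0
      have hc : c ≠ 0 := by rintro rfl; simp at hx0
      have : 0 < Complex.normSq c := Complex.normSq_pos.2 hc
      rw [qf_zero]
      have := mul_pos this hq
      nlinarith
    · have h1 := hWp w hw hw0
      have := mul_nonneg (Complex.normSq_nonneg c) hq.le
      nlinarith
  · have h1 := Submodule.finrank_sup_add_finrank_inf_eq W (Submodule.span ℂ {t})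
    have h2 : W ⊓ Submodule.span ℂ {t} = ⊥ := by
      rw [eq_bot_iff]
      rintro x ⟨hx, hz⟩
      obtain ⟨c, rfl⟩ := Submodule.mem_span_singleton.1 hz
      have := hW hx v hv
      simp [htv] at this
      simp [this]
    have ht0 : t ≠ 0 := by rintro rfl; simp at htv
    rw [h2, finrank_bot, finrank_span_singleton ht0] at h1
    omega

/-- nondegenerate signature on `suppOn U` with negative index `k` -/
def Good (M : Matrix ι ι ℂ) (U : Finset ι) (k : ℕ) : Prop :=
  ∃ P N : Submodule ℂ (ι → ℂ), P ≤ suppOn U ∧ N ≤ suppOn U ∧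
    (∀ x ∈ P, x ≠ 0 → 0 < qf M x) ∧ (∀ x ∈ N, x ≠ 0 → qf M x < 0) ∧
    Module.finrank ℂ P + k = U.card ∧ Module.finrank ℂ N = k

theorem Good.congr {M M' : Matrix ι ι ℂ} {U : Finset ι} {k : ℕ}
    (h : ∀ i ∈ U, ∀ j ∈ U, M i j = M' i j) (hg : Good M U k) : Good M' U k := by
  obtain ⟨P, N, hP, hN, hp, hn, h1, h2⟩ := hg
  exact ⟨P, N, hP, hN, fun x hx h0 => qf_congr h (hP hx) ▸ hp x hx h0,
    fun x hx h0 => qf_congr h (hN hx) ▸ hn x hx h0, h1, h2⟩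

theorem Good.nondeg {M : Matrix ι ι ℂ} (hM : M.IsHermitian) {U : Finset ι} {k : ℕ}
    (hg : Good M U k) {x : ι → ℂ} (hx : x ∈ suppOn U) (h : ∀ i ∈ U, (M *ᵥ x) i = 0) : x = 0 := by
  obtain ⟨P, N, hP, hN, hp, hn, h1, h2⟩ := hg
  have e1 := Submodule.finrank_sup_add_finrank_inf_eq P N
  have e2 : P ⊓ N = ⊥ := by
    rw [eq_bot_iff]
    rintro y ⟨hy1, hy2⟩
    by_contra h0
    have h0 : y ≠ 0 := by simpa using h0
    linarith [hp y hy1 h0, hn y hy2 h0]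
  rw [e2, finrank_bot] at e1
  have e3 : P ⊔ N = suppOn U := by
    refine Submodule.eq_of_le_of_finrank_eq (sup_le hP hN) ?_
    rw [finrank_suppOn]; omega
  rw [← e3] at hx
  obtain ⟨p, hpP, m, hmN, rfl⟩ := Submodule.mem_sup.1 hx
  have a1 := bf_zero (hP hpP) h
  have a2 := bf_zero (hN hmN) h
  rw [bf_add_right] at a1 a2
  rw [bf_symm hM p m] at a2
  have a3 : qf M p = qf M m := by
    have b1 := congrArg Complex.re a1
    have b2 := congrArg Complex.re a2
    simp at b1 b2
    simp only [qf]
    linarith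
  by_cases hp0 : p = 0
  · by_cases hm0 : m = 0
    · simp [hp0, hm0]
    · have := hn m hmN hm0
      rw [← a3, hp0, qf_zero] at this
      linarith
  · have h3 := hp p hpP hp0
    by_cases hm0 : m = 0
    · rw [a3, hm0, qf_zero] at h3; linarith
    · linarith [hn m hmN hm0]

theorem Good.proj {M : Matrix ι ι ℂ} (hM : M.IsHermitian) {S : Finset ι} {k : ℕ}
    (hg : Good M S k) : ∃ π : (ι → ℂ) →ₗ[ℂ] (ι → ℂ), ∀ x, π x ∈ suppOn S ∧
      ∀ i ∈ S, (M *ᵥ (π x)) i = (M *ᵥ x) i := by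
  let f : (ι → ℂ) →ₗ[ℂ] (ι → ℂ) :=
    { toFun := fun x i => if i ∈ S then (M *ᵥ x) i else x i
      map_add' := by
        intro x y; ext i
        by_cases h : i ∈ S <;> simp [h, mulVec_add]
      map_smul' := by
        intro c x; ext i
        by_cases h : i ∈ S <;> simp [h, mulVec_smul] }
  let g : (ι → ℂ) →ₗ[ℂ] (ι → ℂ) :=
    { toFun := fun x i => if i ∈ S then (M *ᵥ x) i else 0
      map_add' := by
        intro x y; ext i
        by_cases h : i ∈ S <;> simp [h, mulVec_add]
      map_smul' := by
        intro c x; ext i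
        by_cases h : i ∈ S <;> simp [h, mulVec_smul] }
  have hf : Function.Injective f := by
    rw [← LinearMap.ker_eq_bot, eq_bot_iff]
    intro x hx
    have hx : f x = 0 := hx
    have hxi : ∀ i, (if i ∈ S then (M *ᵥ x) i else x i) = 0 := fun i => congrFun hx i
    have := hg.nondeg hM (x := x) (fun i hi => by simpa [hi] using hxi i)
      (fun i hi => by simpa [hi] using hxi i)
    simpa using this
  let e := LinearEquiv.ofInjectiveEndo f hf
  refine ⟨e.symm.toLinearMap ∘ₗ g, fun x => ?_⟩
  have h : f (e.symm (g x)) = g x := e.apply_symm_apply (g x)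
  have hi : ∀ i, (if i ∈ S then (M *ᵥ (e.symm (g x))) i else (e.symm (g x)) i) =
    if i ∈ S then (M *ᵥ x) i else 0 := fun i => congrFun h i
  refine ⟨fun i hiS => ?_, fun i hiS => ?_⟩
  · simpa [hiS] using hi i
  · simpa [hiS] using hi i

theorem step {M' : Matrix ι ι ℂ} (hM' : M'.IsHermitian) {U S : Finset ι} {v : ι} (hv : v ∉ U)
    (hSU : S ⊆ U) {k kC k2 : ℕ} (hU : Good M' U k) (hS : Good M' S kC)
    (hS2 : Good M' (insert v S) k2) :
    ∃ M : Matrix ι ι ℂ, M.IsHermitian ∧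
      (∀ i j, M i j ≠ M' i j → (i = v ∧ j ∈ U ∧ j ∉ S) ∨ (j = v ∧ i ∈ U ∧ i ∉ S)) ∧
      (Good M (insert v U) k ∨ ∃ l, k + 1 ≤ l ∧ Good M (insert v U) (k + 1) ∧
        Good M' (insert v S) l) := by
  obtain ⟨π, hπ⟩ := hS.proj hM'
  have hvS : v ∉ S := fun h => hv (hSU h)
  set u : ι → ℂ := Pi.single v 1 - π (Pi.single v 1) with hu
  have huv : u v = 1 := by simp [hu, (hπ (Pi.single v 1)).1 v hvS]
  have huS : u ∈ suppOn (insert v S) := by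
    intro i hi
    rw [Finset.mem_insert, not_or] at hi
    simp [hu, (hπ (Pi.single v 1)).1 i hi.2, hi.1]
  have hMu : ∀ i ∈ S, (M' *ᵥ u) i = 0 := by
    intro i hi
    rw [hu, mulVec_sub, Pi.sub_apply, (hπ _).2 i hi, sub_self]
  have hs0 : qf M' u ≠ 0 := by
    intro h0
    have hb : bf M' u u = (M' *ᵥ u) v := by
      rw [bf, dotProduct, Finset.sum_eq_single v]
      · simp [huv]
      · intro i _ hi
        by_cases hiS : i ∈ S
        · simp [hMu i hiS]
        · simp [huS i (by simp [hi, hiS])]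
      · simp
    have hb0 : bf M' u u = 0 := by
      have h1 := bf_symm hM' u u
      have h2 := congrArg Complex.im h1
      simp at h2
      apply Complex.ext
      · exact h0
      · simp; linarith
    have : u = 0 := hS2.nondeg hM' huS (by
      intro i hi
      rw [Finset.mem_insert] at hi
      rcases hi with rfl | hi
      · rw [← hb, hb0]
      · exact hMu i hi)
    rw [this] at huv
    simp at huv
  -- the general construction
  have main : ∀ y ∈ suppOn U, (∀ i ∈ S, (M' *ᵥ y) i = 0) →
      ∃ M : Matrix ι ι ℂ, M.IsHermitian ∧
      (∀ i j, M i j ≠ M' i j → (i = v ∧ j ∈ U ∧ j ∉ S) ∨ (j = v ∧ i ∈ U ∧ i ∉ S)) ∧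
      (∀ i ∈ U, ∀ j ∈ U, M i j = M' i j) ∧
      ∃ t ∈ suppOn (insert v U), t v = 1 ∧ (∀ i ∈ U, (M *ᵥ t) i = 0) ∧
        qf M t = qf M' u - qf M' y := by
    intro y hy hyS
    let c : ι → ℂ := fun i => if i ∈ U then (M' *ᵥ (y + π (Pi.single v 1))) i else M' i v
    have hcS : ∀ i ∈ S, c i = M' i v := by
      intro i hi
      simp only [c, hSU hi, if_true, mulVec_add, Pi.add_apply, hyS i hi, zero_add]
      rw [(hπ _).2 i hi]
      simp
    have hcv : c v = M' v v := by simp [c, hv]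
    have hcU : ∀ i, i ∉ U → c i = M' i v := by intro i hi; simp [c, hi]
    let M : Matrix ι ι ℂ := fun i j => if j = v then c i else if i = v then star (c j) else M' i j
    have hMv : ∀ i, M i v = c i := by intro i; simp [M]
    have hMvj : ∀ j, j ≠ v → M v j = star (c j) := by intro j hj; simp [M, hj]
    have hMo : ∀ i j, i ≠ v → j ≠ v → M i j = M' i j := by intro i j hi hj; simp [M, hi, hj]
    have hM's : ∀ i j, M' i j = star (M' j i) := fun i j => (hM'.apply i j).symm
    have hM : M.IsHermitian := by
      ext i j
      rw [conjTranspose_apply]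
      by_cases hi : i = v
      · subst hi
        by_cases hj : j = i
        · subst hj; rw [hMv, hcv]; exact (hM's _ _).symm
        · rw [hMv, hMvj j hj]
      · by_cases hj : j = v
        · subst hj
          rw [hMv, hMvj i hi, star_star]
        · rw [hMo i j hi hj, hMo j i hj hi]; exact (hM's _ _).symm
    have hne : ∀ u ∈ U, u ≠ v := fun u hu h => hv (h ▸ hu)
    have hUU : ∀ i ∈ U, ∀ j ∈ U, M i j = M' i j :=
      fun i hi j hj => hMo i j (hne i hi) (hne j hj)
    have hagree : ∀ i, i ∉ U ∨ i ∈ S → c i = M' i v := by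
      rintro i (h | h)
      · exact hcU i h
      · exact hcS i h
    have hdiff : ∀ i j, M i j ≠ M' i j →
        (i = v ∧ j ∈ U ∧ j ∉ S) ∨ (j = v ∧ i ∈ U ∧ i ∉ S) := by
      intro i j hij
      by_contra hcon
      apply hij
      by_cases hj : j = v
      · subst hj
        rw [hMv]
        apply hagree
        tauto
      · by_cases hi : i = v
        · subst hi
          rw [hMvj j hj, hM's i j]
          congr 1
          apply hagree
          tauto
        · exact hMo i j hi hj
    have hMx : ∀ i ∈ U, ∀ x ∈ suppOn U, (M *ᵥ x) i = (M' *ᵥ x) i := by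
      intro i hi x hx
      simp only [mulVec, dotProduct]
      refine Finset.sum_congr rfl fun j _ => ?_
      by_cases hj : j ∈ U
      · rw [hUU i hi j hj]
      · simp [hx j hj]
    have hπU : π (Pi.single v 1) ∈ suppOn U := suppOn_mono hSU (hπ _).1
    have hyu : y + π (Pi.single v 1) ∈ suppOn U := add_mem hy hπU
    refine ⟨M, hM, hdiff, hUU, u - y, ?_, ?_, ?_, ?_⟩
    · exact sub_mem (suppOn_mono (Finset.insert_subset_insert _ hSU) huS)
        (suppOn_mono (Finset.subset_insert _ _) hy)
    · simp [huv, hy v hv]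
    · intro i hi
      have : u - y = Pi.single v 1 - (y + π (Pi.single v 1)) := by rw [hu]; abel
      rw [this, mulVec_sub, Pi.sub_apply, hMx i hi _ hyu]
      simp [hMv, c, hi]
    · have hMt : ∀ i ∈ U, (M *ᵥ (u - y)) i = 0 := by
        intro i hi
        have : u - y = Pi.single v 1 - (y + π (Pi.single v 1)) := by rw [hu]; abel
        rw [this, mulVec_sub, Pi.sub_apply, hMx i hi _ hyu]
        simp [hMv, c, hi]
      have h1 := qf_add hM hy hMt
      rw [add_sub_cancel] at h1
      have h2 : qf M u = qf M' u := by
        refine qf_congr (U := insert v S) ?_ huS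
        intro i hi j hj
        by_contra hcon
        rw [Finset.mem_insert] at hi hj
        rcases hdiff i j hcon with ⟨rfl, h, h'⟩ | ⟨rfl, h, h'⟩
        · rcases hj with rfl | hj
          · exact hv h
          · exact h' hj
        · rcases hi with rfl | hi
          · exact hv h
          · exact h' hi
      rw [qf_congr hUU hy, h2] at h1
      linarith
  have fin1 : (∃ y ∈ suppOn U, (∀ i ∈ S, (M' *ᵥ y) i = 0) ∧ qf M' y < qf M' u) → 
      ∃ M : Matrix ι ι ℂ, M.IsHermitian ∧
      (∀ i j, M i j ≠ M' i j → (i = v ∧ j ∈ U ∧ j ∉ S) ∨ (j = v ∧ i ∈ U ∧ i ∉ S)) ∧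
      Good M (insert v U) k := by
    rintro ⟨y, hy, hyS, hlt⟩
    obtain ⟨M, hM, hd, hUU, t, ht, htv, hMt, hq⟩ := main y hy hyS
    refine ⟨M, hM, hd, ?_⟩
    obtain ⟨P, N, hP, hN, hp, hn, h1, h2⟩ := hU.congr (fun i hi j hj => (hUU i hi j hj).symm)
    obtain ⟨P', hP', hp', hr⟩ := ext_sub hM hv htv ht hMt 1 (by rw [hq]; linarith) P hP
      (by simpa using hp)
    refine ⟨P', N, hP', hN.trans (suppOn_mono (Finset.subset_insert _ _)), by simpa using hp',
      hn, ?_, h2⟩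
    rw [Finset.card_insert_of_notMem hv]
    omega
  by_cases hy : ∃ y ∈ suppOn U, (∀ i ∈ S, (M' *ᵥ y) i = 0) ∧ qf M' y < qf M' u
  · obtain ⟨M, h1, h2, h3⟩ := fin1 hy
    exact ⟨M, h1, h2, Or.inl h3⟩
  push Not at hy
  have hsneg : qf M' u < 0 := by
    have := hy 0 (zero_mem _) (by simp)
    rw [qf_zero] at this
    exact lt_of_le_of_ne this hs0
  have hnn : ∀ y ∈ suppOn U, (∀ i ∈ S, (M' *ᵥ y) i = 0) → 0 ≤ qf M' y := by
    intro y hyU hyS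
    by_contra hneg
    push Not at hneg
    -- scaling
    obtain ⟨r, hr⟩ : ∃ r : ℝ, r * r * qf M' y < qf M' u := by
      refine ⟨1 + qf M' u / qf M' y, ?_⟩
      have hd : 0 < qf M' u / qf M' y := div_pos_of_neg_of_neg hsneg hneg
      have e : qf M' u = (qf M' u / qf M' y) * qf M' y := (div_mul_cancel₀ _ hneg.ne).symm
      set d := qf M' u / qf M' y
      rw [e]
      nlinarith [mul_pos hd hd]
    have := hy ((r : ℂ) • y) (Submodule.smul_mem _ _ hyU)
      (by intro i hi; simp [mulVec_smul, hyS i hi])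
    rw [qf_smul, Complex.normSq_ofReal] at this
    linarith
  obtain ⟨M, hM, hd, hUU, t, ht, htv, hMt, hq⟩ := main 0 (zero_mem _) (by simp)
  refine ⟨M, hM, hd, Or.inr ⟨kC + 1, ?_, ?_, ?_⟩⟩
  · obtain ⟨P, N, hP, hN, hp, hn, h1, h2⟩ := hU
    obtain ⟨PC, NC, hPC, hNC, hpC, hnC, h1C, h2C⟩ := hS
    have hdec : ∀ x ∈ suppOn U, qf M' (π x) ≤ qf M' x := by
      intro x hx
      have hz : ∀ i ∈ S, (M' *ᵥ (x - π x)) i = 0 := by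
        intro i hi
        rw [mulVec_sub, Pi.sub_apply, (hπ _).2 i hi, sub_self]
      have h1 := qf_add hM' (hπ x).1 hz
      have h2 := hnn (x - π x) (sub_mem hx (suppOn_mono hSU (hπ x).1)) hz
      rw [add_sub_cancel] at h1
      linarith
    have hinj : Module.finrank ℂ (N.map π) = Module.finrank ℂ N := by
      have hi : Function.Injective (π.domRestrict N) := by
        rw [← LinearMap.ker_eq_bot, eq_bot_iff]
        rintro ⟨x, hx⟩ h0
        have h0 : π x = 0 := h0
        have b := hdec x (hN hx)
        rw [h0, qf_zero] at b
        by_contra hx0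
        have c := hn x hx (by rintro rfl; exact hx0 (by simp))
        linarith
      have := LinearMap.finrank_range_of_inj hi
      rwa [LinearMap.range_domRestrict] at this
    have := finrank_le_of_disj S PC (N.map π) hPC (by
      rintro _ ⟨x, hx, rfl⟩
      exact (hπ x).1) (by
      rintro _ hxP ⟨x, hx, rfl⟩
      by_contra h0
      have a := hpC _ hxP h0
      have b := hdec x (hN hx)
      have c := hn x hx (by rintro rfl; simp at h0)
      linarith)
    omega
  · obtain ⟨P, N, hP, hN, hp, hn, h1, h2⟩ := hU.congr (fun i hi j hj => (hUU i hi j hj).symm)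
    obtain ⟨N', hN', hn', hr⟩ := ext_sub hM hv htv ht hMt (-1)
      (by rw [hq, qf_zero]; linarith) N hN (by simpa using hn)
    refine ⟨P, N', hP.trans (suppOn_mono (Finset.subset_insert _ _)), hN', hp,
      by simpa using hn', ?_, by omega⟩
    rw [Finset.card_insert_of_notMem hv]
    omega
  · obtain ⟨P, N, hP, hN, hp, hn, h1, h2⟩ := hS
    obtain ⟨N', hN', hn', hr⟩ := ext_sub hM' hvS huv huS hMu (-1)
      (by linarith) N hN (by simpa using hn)
    refine ⟨P, N', hP.trans (suppOn_mono (Finset.subset_insert _ _)), hN', hp,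
      by simpa using hn', ?_, by omega⟩
    rw [Finset.card_insert_of_notMem hvS]
    omega

end
theorem qf_shift {ι : Type*} [Fintype ι] [DecidableEq ι] (A : Matrix ι ι ℂ) (ε : ℝ) (x : ι → ℂ) :
    qf (A - (ε : ℂ) • 1) x = qf A x - ε * ∑ i, Complex.normSq (x i) := by
  have : bf (A - (ε : ℂ) • 1) x x = bf A x x - (ε : ℂ) * ((∑ i, Complex.normSq (x i) : ℝ) : ℂ) := by
    simp only [bf, sub_mulVec, dotProduct_sub, smul_mulVec, one_mulVec, dotProduct_smul,
      smul_eq_mul]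
    congr 2
    push_cast
    refine Finset.sum_congr rfl fun i _ => ?_
    rw [Complex.normSq_eq_conj_mul_self]
    rfl
  rw [qf, this, Complex.sub_re, Complex.re_ofReal_mul, Complex.ofReal_re, qf]

theorem sum_normSq_pos {ι : Type*} [Fintype ι] {x : ι → ℂ} (hx : x ≠ 0) :
    0 < ∑ i, Complex.normSq (x i) := by
  obtain ⟨i, hi⟩ := Function.ne_iff.1 hx
  exact Finset.sum_pos' (fun i _ => Complex.normSq_nonneg _)
    ⟨i, Finset.mem_univ _, Complex.normSq_pos.2 hi⟩

theorem spec {m ι : Type*} [Fintype m] [DecidableEq m] [Fintype ι] [DecidableEq ι]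
    (C : Matrix m m ℂ) (hC : C.IsHermitian) (A : Matrix ι ι ℂ) (f : m → ι)
    (hf : Function.Injective f) (hCA : ∀ i j, A (f i) (f j) = C i j) (U : Finset ι)
    (hU : ∀ i, f i ∈ U) :
    ∃ δ : ℝ, 0 < δ ∧ ∃ P N : Submodule ℂ (ι → ℂ), P ≤ suppOn U ∧ N ≤ suppOn U ∧
      Module.finrank ℂ P + (negCount hC + zeroCount hC) = Fintype.card m ∧
      Module.finrank ℂ N = negCount hC + zeroCount hC ∧
      (∀ x ∈ P, δ * ∑ i, Complex.normSq (x i) ≤ qf A x) ∧ (∀ x ∈ N, qf A x ≤ 0) := by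
  classical
  let L : (m → ℂ) →ₗ[ℂ] (ι → ℂ) := Function.ExtendByZero.linearMap ℂ f ∘ₗ
    Matrix.mulVecLin (hC.eigenvectorUnitary : Matrix m m ℂ)
  have hLf : ∀ z i, L z (f i) = ((hC.eigenvectorUnitary : Matrix m m ℂ) *ᵥ z) i := by
    intro z i
    exact hf.extend_apply _ _ i
  have hL0 : ∀ z j, (¬ ∃ i, f i = j) → L z j = 0 := by
    intro z j hj
    exact Function.extend_apply' _ _ _ hj
  have hLU : ∀ z, L z ∈ suppOn U := by
    intro z j hj
    apply hL0
    rintro ⟨i, rfl⟩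
    exact hj (hU i)
  have hsum : ∀ (z : m → ℂ) (F : ι → ℂ), (∀ j, (¬ ∃ i, f i = j) → F j = 0) →
      ∑ j, F j = ∑ i, F (f i) := by
    intro z F hF
    symm
    refine Finset.sum_of_injOn f hf.injOn (by simp) ?_ (by simp)
    intro j _ hj
    apply hF
    simpa using hj
  have hUU : (hC.eigenvectorUnitary : Matrix m m ℂ)ᴴ * (hC.eigenvectorUnitary : Matrix m m ℂ) = 1 :=
    Unitary.coe_star_mul_self hC.eigenvectorUnitary
  have hdot : ∀ z : m → ℂ, star (L z) ⬝ᵥ L z = star z ⬝ᵥ z := by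
    intro z
    rw [dotProduct, hsum z _ (by intro j hj; simp [hL0 z j hj])]
    simp only [Pi.star_apply, hLf]
    change star ((hC.eigenvectorUnitary : Matrix m m ℂ) *ᵥ z) ⬝ᵥ _ = _
    rw [star_mulVec, ← dotProduct_mulVec, mulVec_mulVec, hUU, one_mulVec]
  have hnorm : ∀ x : m → ℂ, star x ⬝ᵥ x = ((∑ i, Complex.normSq (x i) : ℝ) : ℂ) := by
    intro x
    push_cast
    refine Finset.sum_congr rfl fun i _ => ?_
    rw [Complex.normSq_eq_conj_mul_self]; rfl
  have hnorm' : ∀ x : ι → ℂ, star x ⬝ᵥ x = ((∑ i, Complex.normSq (x i) : ℝ) : ℂ) := by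
    intro x
    push_cast
    refine Finset.sum_congr rfl fun i _ => ?_
    rw [Complex.normSq_eq_conj_mul_self]; rfl
  have hns : ∀ z, ∑ i, Complex.normSq (L z i) = ∑ i, Complex.normSq (z i) := by
    intro z
    have := hdot z
    rw [hnorm, hnorm'] at this
    exact_mod_cast this
  have hCU : C * (hC.eigenvectorUnitary : Matrix m m ℂ) =
      (hC.eigenvectorUnitary : Matrix m m ℂ) * diagonal (fun i => (hC.eigenvalues i : ℂ)) := by
    have h := hC.spectral_theorem
    rw [Unitary.conjStarAlgAut_apply] at h
    have h2 : star (hC.eigenvectorUnitary : Matrix m m ℂ) * (hC.eigenvectorUnitary : Matrix m m ℂ) = 1 := hUU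
    have h3 := congrArg (fun X => X * (hC.eigenvectorUnitary : Matrix m m ℂ)) h
    rw [mul_assoc _ (star _), h2, mul_one] at h3
    exact h3
  have hq : ∀ z, qf A (L z) = ∑ i, hC.eigenvalues i * Complex.normSq (z i) := by
    intro z
    have h1 : bf A (L z) (L z) = ((∑ i, hC.eigenvalues i * Complex.normSq (z i) : ℝ) : ℂ) := by
      rw [bf, dotProduct, hsum z _ (by intro j hj; simp [hL0 z j hj])]
      have h2 : ∀ i, (A *ᵥ L z) (f i) = (C *ᵥ ((hC.eigenvectorUnitary : Matrix m m ℂ) *ᵥ z)) i := by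
        intro i
        rw [mulVec, dotProduct, hsum z _ (by intro j hj; simp [hL0 z j hj])]
        simp only [hCA, hLf]
        rfl
      simp only [Pi.star_apply, hLf, h2]
      change star ((hC.eigenvectorUnitary : Matrix m m ℂ) *ᵥ z) ⬝ᵥ
        (C *ᵥ ((hC.eigenvectorUnitary : Matrix m m ℂ) *ᵥ z)) = _
      rw [star_mulVec, ← dotProduct_mulVec, mulVec_mulVec, mulVec_mulVec, mul_assoc, hCU, ← mul_assoc, hUU,
        one_mul]
      push_cast
      refine Finset.sum_congr rfl fun i _ => ?_
      rw [mulVec_diagonal, Complex.normSq_eq_conj_mul_self, Pi.star_apply]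
      simp only [RCLike.star_def]
      ring
    rw [qf, h1, Complex.ofReal_re]
  have hinj : Function.Injective L := by
    rw [← LinearMap.ker_eq_bot, eq_bot_iff]
    intro z hz
    have hz : L z = 0 := hz
    by_contra h0
    have h0 : z ≠ 0 := by simpa using h0
    have := sum_normSq_pos h0
    rw [← hns, hz] at this
    simp at this
  have hfr : ∀ J : Finset m, Module.finrank ℂ ((suppOn J).map L) = J.card := by
    intro J
    rw [LinearEquiv.finrank_eq (Submodule.equivMapOfInjective L hinj (suppOn J)).symm,
      finrank_suppOn]
  let J : Finset m := Finset.univ.filter (fun i => 0 < hC.eigenvalues i)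
  have hJc : Jᶜ.card = negCount hC + zeroCount hC := by
    rw [negCount, zeroCount, Fintype.card_subtype, Fintype.card_subtype,
      ← Finset.card_union_of_disjoint]
    · congr 1
      ext i
      simp [J, le_iff_lt_or_eq]
    · rw [Finset.disjoint_filter]
      intro i _ h1 h2
      exact h1.ne h2
  obtain ⟨δ, hδ, hδJ⟩ : ∃ δ : ℝ, 0 < δ ∧ ∀ i ∈ J, δ ≤ hC.eigenvalues i := by
    by_cases hJ : J.Nonempty
    · obtain ⟨i, hi, h⟩ := Finset.exists_min_image J hC.eigenvalues hJ
      exact ⟨_, (Finset.mem_filter.1 hi).2, h⟩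
    · exact ⟨1, one_pos, fun i hi => absurd ⟨i, hi⟩ hJ⟩
  refine ⟨δ, hδ, (suppOn J).map L, (suppOn Jᶜ).map L, ?_, ?_, ?_, ?_, ?_, ?_⟩
  · rintro _ ⟨z, _, rfl⟩
    exact hLU z
  · rintro _ ⟨z, _, rfl⟩
    exact hLU z
  · rw [hfr, ← hJc, Finset.card_add_card_compl]
  · rw [hfr, hJc]
  · rintro _ ⟨z, hz, rfl⟩
    rw [hns, hq, Finset.mul_sum]
    refine Finset.sum_le_sum fun i _ => ?_
    by_cases hi : i ∈ J
    · exact mul_le_mul_of_nonneg_right (hδJ i hi) (Complex.normSq_nonneg _)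
    · simp [hz i hi]
  · rintro _ ⟨z, hz, rfl⟩
    rw [hq]
    refine Finset.sum_nonpos fun i _ => ?_
    by_cases hi : i ∈ J
    · simp [hz i (by simpa using hi)]
    · have : hC.eigenvalues i ≤ 0 := by simpa [J] using hi
      exact mul_nonpos_of_nonpos_of_nonneg this (Complex.normSq_nonneg _)

theorem complete_all {n : ℕ} {G : SimpleGraph (Fin n)} (hG : IsChordal G)
    {A : Matrix (Fin n) (Fin n) ℂ} (hA : A.IsHermitian)
    (hcl : ∀ K : Finset (Fin n), G.IsClique (K : Set (Fin n)) → ∃ k, Good A K k)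
    (U : Finset (Fin n)) : ∃ M : Matrix (Fin n) (Fin n) ℂ, M.IsHermitian ∧
      (∀ i j : Fin n, (i = j ∨ G.Adj i j) → M i j = A i j) ∧
      ∃ (K : Finset (Fin n)) (k l : ℕ), G.IsClique (K : Set (Fin n)) ∧ k ≤ l ∧ Good M U k ∧
        Good A K l := by
  classical
  induction U using Finset.strongInduction with
  | H U ih =>
    by_cases hU : U.Nonempty
    · obtain ⟨w, hwU, hw⟩ := exists_simplicial hG U hU
      have hwn : w ∉ U.erase w := by simp
      obtain ⟨M', hM', hagr, K, k, l, hK, hkl, hg, hgK⟩ := ih (U.erase w) (Finset.erase_ssubset hwU)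
      let S : Finset (Fin n) := (U.erase w).filter (fun a => G.Adj w a)
      have hS : G.IsClique (S : Set (Fin n)) := by
        intro a ha b hb hab
        simp [S] at ha hb
        exact hw a ha.1.2 b hb.1.2 ha.2 hb.2 hab
      have hS2 : G.IsClique ((insert w S : Finset (Fin n)) : Set (Fin n)) := by
        rw [Finset.coe_insert]
        refine hS.insert ?_
        intro b hb _
        exact (Finset.mem_filter.1 hb).2
      have hagK : ∀ K : Finset (Fin n), G.IsClique (K : Set (Fin n)) →
          ∀ i ∈ K, ∀ j ∈ K, A i j = M' i j := by
        intro K hK i hi j hj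
        by_cases hij : i = j
        · exact (hagr i j (Or.inl hij)).symm
        · exact (hagr i j (Or.inr (hK hi hj hij))).symm
      obtain ⟨kC, hkC⟩ := hcl S hS
      obtain ⟨k2, hk2⟩ := hcl _ hS2
      obtain ⟨M, hM, hd, hgood⟩ := step hM' hwn (Finset.filter_subset _ _) hg
        (hkC.congr (hagK S hS)) (hk2.congr (hagK _ hS2))
      rw [Finset.insert_erase hwU] at hgood
      refine ⟨M, hM, ?_, ?_⟩
      · intro i j hij
        rw [← hagr i j hij]
        by_contra hcon
        rcases hd i j hcon with ⟨rfl, h1, h2⟩ | ⟨rfl, h1, h2⟩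
        · rcases hij with rfl | hij
          · exact hwn h1
          · exact h2 (Finset.mem_filter.2 ⟨h1, hij⟩)
        · rcases hij with rfl | hij
          · exact hwn h1
          · exact h2 (Finset.mem_filter.2 ⟨h1, hij.symm⟩)
      · rcases hgood with h | ⟨l', hl, h, h'⟩
        · exact ⟨K, k, l, hK, hkl, h, hgK⟩
        · exact ⟨_, k + 1, l', hS2, hl, h,
            h'.congr (fun i hi j hj => (hagK _ hS2 i hi j hj).symm)⟩
    · rw [Finset.not_nonempty_iff_eq_empty] at hU
      subst hU
      obtain ⟨k, hk⟩ := hcl ∅ (by simp)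
      exact ⟨A, hA, fun _ _ _ => rfl, ∅, k, k, by simp, le_rfl, hk, hk⟩

theorem count_congr {m : Type*} [Fintype m] [DecidableEq m] {C C' : Matrix m m ℂ} (h : C = C')
    (hC : C.IsHermitian) (hC' : C'.IsHermitian) :
    negCount hC + zeroCount hC = negCount hC' + zeroCount hC' := by
  subst h; rfl

theorem exists_maxClique {n : ℕ} (G : SimpleGraph (Fin n)) (K : Finset (Fin n))
    (hK : G.IsClique (K : Set (Fin n))) : ∃ K', K ⊆ K' ∧ IsMaxClique G K' := by
  classical
  obtain ⟨K', hK', h⟩ := Finset.exists_max_image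
    (Finset.univ.filter (fun T : Finset (Fin n) => K ⊆ T ∧ G.IsClique (T : Set (Fin n))))
    Finset.card ⟨K, by simp [hK]⟩
  simp only [Finset.mem_filter, Finset.mem_univ, true_and] at hK' h
  refine ⟨K', hK'.1, hK'.2, fun T hT hKT => ?_⟩
  exact (Finset.eq_of_subset_of_card_le hKT (h T ⟨hK'.1.trans hKT, hT⟩)).symm

/-- Johnson–Rodman (a): if `G` is chordal and `A` is partial Hermitian with graph `G`,
there is a Hermitian completion `M` with `i₋(M) + i₀(M)` equal to the maximum of
`i₋(A(K)) + i₀(A(K))` over maximal cliques `K` of `G`. -/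
theorem stmt7 {n : ℕ} (G : SimpleGraph (Fin n)) (hG : IsChordal G)
    (A : Matrix (Fin n) (Fin n) ℂ) (hA : IsPartialHermitian G A) :
    ∃ M : Matrix (Fin n) (Fin n) ℂ, ∃ hM : M.IsHermitian,
      (∀ i j : Fin n, (i = j ∨ G.Adj i j) → M i j = A i j) ∧
      IsGreatest {m : ℕ | ∃ K : Finset (Fin n), IsMaxClique G K ∧
          ∃ hK : (cliqueSub A K).IsHermitian, m = negCount hK + zeroCount hK}
        (negCount hM + zeroCount hM) := by
  classical
  let A0 : Matrix (Fin n) (Fin n) ℂ := fun i j => if i = j ∨ G.Adj i j then A i j else 0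
  have hA0s : ∀ i j, (i = j ∨ G.Adj i j) → A0 i j = A i j := by intro i j h; simp [A0, h]
  have hA0 : A0.IsHermitian := by
    ext i j
    rw [conjTranspose_apply]
    by_cases h : i = j ∨ G.Adj i j
    · have h' : j = i ∨ G.Adj j i := h.imp Eq.symm SimpleGraph.Adj.symm
      rw [hA0s i j h, hA0s j i h']
      rcases h with rfl | h
      · exact Complex.conj_eq_iff_im.2 (hA.1 i)
      · exact (hA.2 j i h.symm).symm
    · have h' : ¬ (j = i ∨ G.Adj j i) := fun h' => h (h'.imp Eq.symm SimpleGraph.Adj.symm)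
      simp [A0, h, h']
  have hsub : ∀ K : Finset (Fin n), (cliqueSub A0 K).IsHermitian := fun K => hA0.submatrix _
  have heq : ∀ K : Finset (Fin n), G.IsClique (K : Set (Fin n)) → cliqueSub A K = cliqueSub A0 K := by
    intro K hK
    ext i j
    symm
    apply hA0s
    by_cases hij : (i : Fin n) = j
    · exact Or.inl hij
    · exact Or.inr (hK i.2 j.2 hij)
  let D : Finset (Fin n) → ℕ := fun K => negCount (hsub K) + zeroCount (hsub K)
  have hspec := fun K : Finset (Fin n) => spec (cliqueSub A0 K) (hsub K) A0 (fun i : K => (i : Fin n))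
    Subtype.val_injective (fun _ _ => rfl) K (fun i => i.2)
  choose δ hδ P N hP hN hPr hNr hPp hNn using hspec
  simp only [Fintype.card_coe] at hPr
  obtain ⟨K0, hK0⟩ := Finite.exists_min δ
  set ε : ℝ := δ K0 / 2 with hε
  have hε0 : 0 < ε := by have := hδ K0; positivity
  have hεK : ∀ K, ε < δ K := fun K => by have := hδ K0; have := hK0 K; linarith
  set A1 : Matrix (Fin n) (Fin n) ℂ := A0 - (ε : ℂ) • 1 with hA1
  have hherm : ((ε : ℂ) • (1 : Matrix (Fin n) (Fin n) ℂ)).IsHermitian := by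
    rw [IsHermitian, conjTranspose_smul, conjTranspose_one]
    simp
  have hA1h : A1.IsHermitian := hA0.sub hherm
  have hPpos : ∀ K, ∀ x ∈ P K, x ≠ 0 → 0 < qf A1 x := by
    intro K x hx h0
    rw [hA1, qf_shift]
    have h1 := hPp K x hx
    have h2 := mul_lt_mul_of_pos_right (hεK K) (sum_normSq_pos h0)
    linarith
  have hgood : ∀ K, Good A1 K (D K) := by
    intro K
    refine ⟨P K, N K, hP K, hN K, hPpos K, ?_, hPr K, hNr K⟩
    intro x hx h0
    rw [hA1, qf_shift]
    have h1 := hNn K x hx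
    have h2 := mul_pos hε0 (sum_normSq_pos h0)
    linarith
  obtain ⟨M1, hM1, hag, K, k, l, hK, hkl, hg, hgK⟩ :=
    complete_all hG hA1h (fun K _ => ⟨D K, hgood K⟩) Finset.univ
  set M : Matrix (Fin n) (Fin n) ℂ := M1 + (ε : ℂ) • 1 with hMdef
  have hM : M.IsHermitian := hM1.add hherm
  have hMA0 : ∀ i j : Fin n, (i = j ∨ G.Adj i j) → M i j = A0 i j := by
    intro i j hij
    rw [hMdef, Matrix.add_apply, hag i j hij, hA1, Matrix.sub_apply, sub_add_cancel]
  obtain ⟨δM, hδM, PM, NM, hPM, hNM, hPMr, hNMr, hPMp, hNMn⟩ := spec M hM M id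
    Function.injective_id (fun _ _ => rfl) Finset.univ (fun i => Finset.mem_univ _)
  set d := negCount hM + zeroCount hM with hd
  rw [Fintype.card_fin] at hPMr
  -- interlacing
  have hlow : ∀ T : Finset (Fin n), G.IsClique (T : Set (Fin n)) → D T ≤ d := by
    intro T hT
    have := finrank_le_of_disj Finset.univ PM (N T) hPM
      ((hN T).trans (suppOn_mono (Finset.subset_univ _))) (by
        intro x hx hxN
        by_contra h0
        have h1 := hPMp x hx
        have h2 := hNn T x hxN
        have h3 : qf M x = qf A0 x := by
          refine qf_congr ?_ (hN T hxN)
          intro i hi j hj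
          apply hMA0
          by_cases hij : i = j
          · exact Or.inl hij
          · exact Or.inr (hT hi hj hij)
        have h4 := mul_pos hδM (sum_normSq_pos h0)
        linarith)
    rw [Finset.card_univ, Fintype.card_fin, hNr T] at this
    change Module.finrank ℂ PM + D T ≤ n at this
    omega
  have hmono : ∀ T T' : Finset (Fin n), T ⊆ T' → D T ≤ D T' := by
    intro T T' hTT
    have := finrank_le_of_disj T' (P T') (N T) (hP T') ((hN T).trans (suppOn_mono hTT)) (by
        intro x hx hxN
        by_contra h0
        have h1 := hPp T' x hx
        have h2 := hNn T x hxN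
        have h4 := mul_pos (hδ T') (sum_normSq_pos h0)
        linarith)
    have h1 := hPr T'
    rw [hNr T] at this
    change Module.finrank ℂ (P T') + D T ≤ _ at this
    change Module.finrank ℂ (P T') + D T' = _ at h1
    omega
  have hl : l ≤ D K := by
    obtain ⟨PK, NK, _, hNK, _, hn, _, h2⟩ := hgK
    have := finrank_le_of_disj K (P K) NK (hP K) hNK (by
      intro x hx hxN
      by_contra h0
      linarith [hPpos K x hx h0, hn x hxN h0])
    have h1 := hPr K
    change Module.finrank ℂ (P K) + D K = _ at h1
    omega
  have hdk : d ≤ k := by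
    obtain ⟨PK, NK, hPK, _, hp, _, h2, _⟩ := hg
    have := finrank_le_of_disj Finset.univ PK NM hPK hNM (by
      intro x hx hxN
      by_contra h0
      have h1 := hp x hx h0
      have h3 := hNMn x hxN
      have h4 : M1 = M - (ε : ℂ) • 1 := by rw [hMdef, add_sub_cancel_right]
      rw [h4, qf_shift] at h1
      have := mul_pos hε0 (sum_normSq_pos h0)
      linarith)
    omega
  obtain ⟨K', hKK', hK'⟩ := exists_maxClique G K hK
  refine ⟨M, hM, fun i j hij => (hMA0 i j hij).trans (hA0s i j hij), ?_, ?_⟩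
  · refine ⟨K', hK', (heq K' hK'.1) ▸ hsub K', ?_⟩
    rw [count_congr (heq K' hK'.1) _ (hsub K')]
    change d = D K'
    have h1 := hlow K' hK'.1
    have h2 := hmono K K' hKK'
    omega
  · rintro m ⟨T, hT, hTh, rfl⟩
    rw [count_congr (heq T hT.1) _ (hsub T)]
    exact hlow T hT.1
end

section
/- Let G be a chordal graph and A a partial Hermitian matrix with graph G such that A(K) is nonsingular for every maximal clique K of G. Then there exists a nonsingular Hermitian completion M of A with i₋(M) equal to the maximum of i₋(A(K)) over all maximal cliques K of G. -/
open Matrix ComplexOrder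

theorem jr_short_edges {V : Type*} (H : SimpleGraph V) {y z : V} (p : H.Walk y z)
    (hp : p.length = H.dist y z) {a b : V} (ha : a ∈ p.support) (hb : b ∈ p.support)
    (hab : H.Adj a b) : s(a, b) ∈ p.edges := by
  obtain ⟨i, hi, hil⟩ := SimpleGraph.Walk.mem_support_iff_exists_getVert.1 ha
  obtain ⟨j, hj, hjl⟩ := SimpleGraph.Walk.mem_support_iff_exists_getVert.1 hb
  have key : ∀ (i j : ℕ) (a b : V), p.getVert i = a → i ≤ p.length → p.getVert j = b →
      j ≤ p.length → H.Adj a b → i < j → s(a, b) ∈ p.edges := by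
    intro i j a b hi hil hj hjl hab hij
    subst hi hj
    by_cases h : j = i + 1
    · subst h
      rw [SimpleGraph.Walk.edges, List.mem_map]
      have hlt : i < p.darts.length := by simpa using hjl
      refine ⟨p.darts[i], List.getElem_mem _, ?_⟩
      rw [SimpleGraph.Walk.darts_getElem_eq_getVert]
      rfl
    · exfalso
      have := SimpleGraph.dist_le ((p.take i).append (SimpleGraph.Walk.cons hab (p.drop j)))
      simp at this
      omega
  rcases lt_trichotomy i j with h | h | h
  · exact key i j a b hi hil hj hjl hab h
  · subst h; rw [hi] at hj; subst hj; exact absurd hab (H.irrefl)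
  · rw [Sym2.eq_swap]; exact key j i b a hj hjl hi hil hab.symm h

theorem jr_chordal_adj {V : Type*} (G : SimpleGraph V) (hG : IsChordal G) (C : Set V)
    (hC : (G.induce C).Connected) {y z b : V} (hb : b ∉ C) (hbC : ∀ c ∈ C, ¬ G.Adj c b)
    (hy : ∃ c ∈ C, G.Adj c y) (hz : ∃ c ∈ C, G.Adj c z)
    (hby : G.Adj b y) (hbz : G.Adj b z) (hyz : y ≠ z) : G.Adj y z := by
  by_contra hn
  obtain ⟨c, hc, hcy⟩ := hy
  obtain ⟨d, hd, hdz⟩ := hz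
  have h1 : (G.induce (C ∪ {c, y})).Connected :=
    G.induce_union_connected hC.preconnected
      (SimpleGraph.induce_pair_connected_of_adj hcy).preconnected ⟨c, hc, by simp⟩
  have h2 : (G.induce ((C ∪ {c, y}) ∪ {d, z})).Connected :=
    G.induce_union_connected h1.preconnected
      (SimpleGraph.induce_pair_connected_of_adj hdz).preconnected ⟨d, by simp [hd], by simp⟩
  set D : Set V := (C ∪ {c, y}) ∪ {d, z} with hD
  have hDm : ∀ x ∈ D, x ∈ C ∨ x = y ∨ x = z := by
    intro x hx
    simp only [hD, Set.mem_union, Set.mem_insert_iff, Set.mem_singleton_iff] at hx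
    rcases hx with (h | h | h) | h | h
    · exact Or.inl h
    · subst h; exact Or.inl hc
    · exact Or.inr (Or.inl h)
    · subst h; exact Or.inl hd
    · exact Or.inr (Or.inr h)
  have hbD : b ∉ D := by
    intro h
    rcases hDm b h with h | h | h
    · exact hb h
    · exact hby.ne h
    · exact hbz.ne h
  let y' : D := ⟨y, by simp [hD]⟩
  let z' : D := ⟨z, by simp [hD]⟩
  obtain ⟨p, hpp, hpl⟩ := h2.exists_path_of_dist y' z'
  let f : G.induce D ↪g G := SimpleGraph.Embedding.induce D
  let q : G.Walk y z := p.map f.toHom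
  have hq : q.IsPath := SimpleGraph.Walk.IsPath.map f.injective hpp
  have hqs : ∀ x, x ∈ q.support ↔ ∃ h : x ∈ D, (⟨x, h⟩ : D) ∈ p.support := by
    intro x
    have hqe : q.support = p.support.map f := SimpleGraph.Walk.support_map _ _
    rw [hqe, List.mem_map]
    constructor
    · rintro ⟨w, hw, rfl⟩
      exact ⟨w.2, hw⟩
    · rintro ⟨h, hw⟩
      exact ⟨_, hw, rfl⟩
  have hbq : b ∉ q.support := fun h => hbD ((hqs b).1 h).1
  have hlen : 2 ≤ q.length := by
    have : q.length = p.length := SimpleGraph.Walk.length_map _ _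
    rw [this]
    by_contra hlt
    have h01 : p.length = 0 ∨ p.length = 1 := by omega
    rcases h01 with h0 | h0
    · have := SimpleGraph.Walk.eq_of_length_eq_zero h0
      exact hyz (congrArg Subtype.val this)
    · have := SimpleGraph.Walk.adj_of_length_eq_one h0
      exact hn this
  let w : G.Walk b b := SimpleGraph.Walk.cons hby (q.concat hbz.symm)
  have hw : w.IsCycle := by
    rw [SimpleGraph.Walk.cons_isCycle_iff]
    refine ⟨hq.concat hbq _, ?_⟩
    rw [SimpleGraph.Walk.edges_concat]
    simp only [List.concat_eq_append, List.mem_append, List.mem_singleton, not_or]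
    refine ⟨fun h => hbq (SimpleGraph.Walk.fst_mem_support_of_mem_edges _ h), ?_⟩
    intro h
    rw [Sym2.eq_iff] at h
    rcases h with ⟨h, _⟩ | ⟨_, h⟩
    · exact hbz.ne h
    · exact hyz h
  obtain ⟨x1, x2, hx1, hx2, hadj, hne⟩ := hG w hw (by simp [w]; omega)
  have hws : ∀ x, x ∈ w.support → x = b ∨ x ∈ q.support := by
    intro x hx
    simp only [w, SimpleGraph.Walk.support_cons, SimpleGraph.Walk.support_concat,
      List.concat_eq_append, List.mem_cons, List.mem_append] at hx
    tauto
  have hwe : ∀ e, e ∈ w.edges ↔ e = s(b, y) ∨ e ∈ q.edges ∨ e = s(z, b) := by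
    intro e
    simp [w, SimpleGraph.Walk.edges_concat]
  have hbx : ∀ x, x ∈ q.support → G.Adj b x → s(b, x) ∈ w.edges := by
    intro x hx hax
    rw [hwe]
    rcases hDm x ((hqs x).1 hx).1 with h | h | h
    · exact absurd hax.symm (hbC x h)
    · subst h; exact Or.inl rfl
    · subst h; exact Or.inr (Or.inr Sym2.eq_swap)
  rcases hws x1 hx1 with h | h <;> rcases hws x2 hx2 with h' | h'
  · subst h; subst h'; exact G.irrefl hadj
  · subst h; exact hne (hbx _ h' hadj)
  · subst h'; rw [Sym2.eq_swap] at hne; exact hne (hbx _ h hadj.symm)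
  · apply hne
    rw [hwe]
    obtain ⟨m1, s1⟩ := (hqs _).1 h
    obtain ⟨m2, s2⟩ := (hqs _).1 h'
    have := jr_short_edges _ p hpl s1 s2 hadj
    right; left
    have hqe : q.edges = p.edges.map (Sym2.map f) := SimpleGraph.Walk.edges_map _ _
    rw [hqe, List.mem_map]
    exact ⟨_, this, rfl⟩

theorem jr_simplicial {V : Type*} [DecidableEq V] (G : SimpleGraph V) (hG : IsChordal G)
    (T : Finset V) : T.Nonempty →
    ∃ v ∈ T, ∀ x ∈ T, ∀ y ∈ T, G.Adj v x → G.Adj v y → x ≠ y → G.Adj x y := by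
  classical
  induction T using Finset.strongInduction with
  | H T ih =>
  intro hT
  by_cases hcl : G.IsClique (T : Set V)
  · obtain ⟨v, hv⟩ := hT
    exact ⟨v, hv, fun x hx y hy _ _ hne => hcl hx hy hne⟩
  · rw [SimpleGraph.isClique_iff, Set.Pairwise] at hcl
    push Not at hcl
    obtain ⟨a, ha, b, hb, hab, hnab⟩ := hcl
    let F := T.powerset.filter (fun C : Finset V => (G.induce (C : Set V)).Connected ∧
      ∃ b ∈ T, b ∉ C ∧ ∀ c ∈ C, ¬ G.Adj c b)
    have hF : ({a} : Finset V) ∈ F := by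
      simp only [F, Finset.mem_filter, Finset.mem_powerset, Finset.singleton_subset_iff]
      refine ⟨ha, ?_, b, hb, by simpa using hab.symm, by simpa using hnab⟩
      rw [Finset.coe_singleton]
      haveI : Nonempty (({a} : Set V)) := ⟨⟨a, rfl⟩⟩
      refine ⟨?_⟩
      intro x y
      have : x = y := Subsingleton.elim _ _
      rw [this]
    obtain ⟨C, hCF, hmax⟩ := Finset.exists_max_image F Finset.card ⟨_, hF⟩
    simp only [F, Finset.mem_filter, Finset.mem_powerset] at hCF
    obtain ⟨hCT, hCc, b', hb'⟩ := hCF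
    obtain ⟨⟨c0, hc0⟩⟩ := hCc.nonempty
    let B := T.filter (fun b => b ∉ C ∧ ∀ c ∈ C, ¬ G.Adj c b)
    have hBT : B ⊂ T := by
      refine ⟨Finset.filter_subset _ _, fun h => ?_⟩
      have := h (hCT hc0)
      simp only [B, Finset.mem_filter] at this
      exact this.2.1 hc0
    obtain ⟨v, hv, hvs⟩ := ih B hBT ⟨b', by simp only [B, Finset.mem_filter]; exact hb'⟩
    have hdom : ∀ x ∈ T, x ∉ C → (∃ c ∈ C, G.Adj c x) → ∀ b ∈ B, G.Adj x b := by
      intro x hx hxC hcx b hbB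
      simp only [B, Finset.mem_filter] at hbB
      by_contra hxb
      have hin : insert x C ∈ F := by
        simp only [F, Finset.mem_filter, Finset.mem_powerset]
        refine ⟨Finset.insert_subset hx hCT, ?_, b, hbB.1, ?_, ?_⟩
        · obtain ⟨c, hc, hcx⟩ := hcx
          have h1 : (G.induce ((C : Set V) ∪ {c, x})).Connected :=
            G.induce_union_connected hCc.preconnected
              (SimpleGraph.induce_pair_connected_of_adj hcx).preconnected ⟨c, hc, by simp⟩
          have : ((insert x C : Finset V) : Set V) = (C : Set V) ∪ {c, x} := by
            ext t
            simp only [Finset.coe_insert, Set.mem_insert_iff, Finset.mem_coe, Set.mem_union,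
              Set.mem_singleton_iff]
            constructor
            · tauto
            · rintro (h | h | h)
              · exact Or.inr h
              · subst h; exact Or.inr hc
              · exact Or.inl h
          rw [this]; exact h1
        · obtain ⟨c, hc, hcx⟩ := hcx
          rw [Finset.mem_insert, not_or]
          refine ⟨?_, hbB.2.1⟩
          rintro rfl
          exact hbB.2.2 c hc hcx
        · intro c hc
          rcases Finset.mem_insert.1 hc with h | h
          · subst h; exact hxb
          · exact hbB.2.2 c h
      have := hmax _ hin
      rw [Finset.card_insert_of_notMem hxC] at this
      omega
    have hvB := hv
    simp only [B, Finset.mem_filter] at hvB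
    refine ⟨v, hvB.1, ?_⟩
    have hcase : ∀ x ∈ T, G.Adj v x → x ∈ B ∨ (x ∉ C ∧ ∃ c ∈ C, G.Adj c x) := by
      intro x hx hvx
      have hxC : x ∉ C := fun h => hvB.2.2 x h hvx.symm
      by_cases h : ∃ c ∈ C, G.Adj c x
      · exact Or.inr ⟨hxC, h⟩
      · left
        simp only [B, Finset.mem_filter]
        push Not at h
        exact ⟨hx, hxC, h⟩
    intro x hx y hy hvx hvy hxy
    rcases hcase x hx hvx with h | h <;> rcases hcase y hy hvy with h' | h'
    · exact hvs x h y h' hvx hvy hxy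
    · exact (hdom y hy h'.1 h'.2 x h).symm
    · exact hdom x hx h.1 h.2 y h'
    · exact jr_chordal_adj G hG C hCc hvB.2.1 (fun c hc => hvB.2.2 c hc) h.2 h'.2 hvx hvy hxy

theorem jr_decomp {V : Type*} [DecidableEq V] (G : SimpleGraph V) (hG : IsChordal G)
    (T : Finset V) : G.IsClique (T : Set V) ∨ ∃ V1 V2 : Finset V, V1 ∪ V2 = T ∧
      G.IsClique ((V1 ∩ V2 : Finset V) : Set V) ∧
      (∀ x ∈ V1, x ∉ V2 → ∀ y ∈ V2, y ∉ V1 → ¬ G.Adj x y) ∧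
      (∃ x ∈ V1, x ∉ V2 ∧ ∀ s ∈ V1 ∩ V2, G.Adj x s) ∧
      (∃ x ∈ V2, x ∉ V1 ∧ ∀ s ∈ V1 ∩ V2, G.Adj x s) := by
  classical
  induction T using Finset.strongInduction with
  | H T ih =>
  rcases T.eq_empty_or_nonempty with rfl | hT
  · left; simp
  obtain ⟨v, hv, hvs⟩ := jr_simplicial G hG T hT
  have hlt : T.erase v ⊂ T := Finset.erase_ssubset hv
  have hTv : insert v (T.erase v) = T := Finset.insert_erase hv
  rcases ih _ hlt with hcl | ⟨V1, V2, hU, hS, hsep, hx1, hx2⟩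
  · by_cases hall : ∀ x ∈ T.erase v, G.Adj v x
    · left
      rw [← hTv, Finset.coe_insert, SimpleGraph.isClique_insert]
      exact ⟨hcl, fun b hb _ => hall b hb⟩
    · right
      push Not at hall
      obtain ⟨x, hx, hvx⟩ := hall
      have hint : (insert v (T.filter (G.Adj v))) ∩ T.erase v = T.filter (G.Adj v) := by
        ext t
        simp only [Finset.mem_inter, Finset.mem_insert, Finset.mem_filter, Finset.mem_erase]
        constructor
        · tauto
        · rintro ⟨h1, h2⟩
          exact ⟨Or.inr ⟨h1, h2⟩, h2.ne', h1⟩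
      refine ⟨insert v (T.filter (G.Adj v)), T.erase v, ?_, ?_, ?_, ?_, ?_⟩
      · ext t
        simp only [Finset.mem_union, Finset.mem_insert, Finset.mem_filter, Finset.mem_erase]
        by_cases h : t = v
        · subst h; simp [hv]
        · simp only [h]; tauto
      · rw [hint]
        intro a ha b hb hab
        simp only [Finset.coe_filter, Set.mem_ofPred_eq] at ha hb
        exact hvs a ha.1 b hb.1 ha.2 hb.2 hab
      · intro a ha ha' b hb hb' hab
        simp only [Finset.mem_insert, Finset.mem_filter, Finset.mem_erase] at ha ha' hb hb'
        have : a = v := by tauto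
        subst this
        tauto
      · rw [hint]
        exact ⟨v, by simp, by simp, fun s hs => (Finset.mem_filter.1 hs).2⟩
      · rw [hint]
        refine ⟨x, hx, ?_, ?_⟩
        · simp only [Finset.mem_insert, Finset.mem_filter, Finset.mem_erase] at hx ⊢
          tauto
        · intro s hs
          refine hcl hx ?_ ?_
          · simp only [Finset.mem_filter] at hs
            simp [hs.1, hs.2.ne']
          · rintro rfl
            exact hvx (Finset.mem_filter.1 hs).2
  · right
    have hvU : v ∉ V1 ∪ V2 := by rw [hU]; simp
    rw [Finset.mem_union, not_or] at hvU
    have hNU : ∀ x ∈ T, G.Adj v x → x ∈ V1 ∨ x ∈ V2 := by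
      intro x hx h
      rw [← Finset.mem_union, hU]
      simp [hx, h.ne']
    by_cases hN : ∀ x ∈ T, G.Adj v x → x ∈ V1
    · have hint : insert v V1 ∩ V2 = V1 ∩ V2 := by
        rw [Finset.insert_inter_of_notMem hvU.2]
      refine ⟨insert v V1, V2, ?_, ?_, ?_, ?_, ?_⟩
      · rw [Finset.insert_union, hU, hTv]
      · rw [hint]; exact hS
      · intro x hx hx2 y hy hy1 hxy
        rw [Finset.mem_insert, not_or] at hy1
        rcases Finset.mem_insert.1 hx with h | h
        · subst h
          refine hy1.2 (hN y ?_ hxy)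
          rw [← hTv, ← hU]; simp [hy]
        · exact hsep x h hx2 y hy hy1.2 hxy
      · rw [hint]
        obtain ⟨x, h1, h2, h3⟩ := hx1
        exact ⟨x, by simp [h1], h2, h3⟩
      · rw [hint]
        obtain ⟨x, h1, h2, h3⟩ := hx2
        refine ⟨x, h1, ?_, h3⟩
        rw [Finset.mem_insert, not_or]
        exact ⟨fun h => hvU.2 (h ▸ h1), h2⟩
    · push Not at hN
      obtain ⟨x0, hx0, hvx0, hx01⟩ := hN
      have hx02 := (hNU x0 hx0 hvx0).resolve_left hx01
      have hN2 : ∀ x ∈ T, G.Adj v x → x ∈ V2 := by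
        intro x hx hvx
        by_contra hx2
        have hx1 := (hNU x hx hvx).resolve_right hx2
        exact hsep x hx1 hx2 x0 hx02 hx01 (hvs x hx x0 hx0 hvx hvx0 (fun h => hx01 (h ▸ hx1)))
      have hint : V1 ∩ insert v V2 = V1 ∩ V2 := by
        rw [Finset.inter_insert_of_notMem hvU.1]
      refine ⟨V1, insert v V2, ?_, ?_, ?_, ?_, ?_⟩
      · rw [Finset.union_insert, hU, hTv]
      · rw [hint]; exact hS
      · intro x hx hx2 y hy hy1 hxy
        rw [Finset.mem_insert, not_or] at hx2
        rcases Finset.mem_insert.1 hy with h | h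
        · subst h
          refine hx2.2 (hN2 x ?_ hxy.symm)
          rw [← hTv, ← hU]; simp [hx]
        · exact hsep x hx hx2.2 y h hy1 hxy
      · rw [hint]
        obtain ⟨x, h1, h2, h3⟩ := hx1
        refine ⟨x, h1, ?_, h3⟩
        rw [Finset.mem_insert, not_or]
        exact ⟨fun h => hvU.1 (h ▸ h1), h2⟩
      · rw [hint]
        obtain ⟨x, h1, h2, h3⟩ := hx2
        exact ⟨x, by simp [h1], h2, h3⟩

theorem jr_quad {ι κ : Type*} [Fintype ι] [Fintype κ] (P : Matrix ι ι ℂ) (L : Matrix ι κ ℂ)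
    (x : κ → ℂ) : star x ⬝ᵥ ((Lᴴ * P * L) *ᵥ x) = star (L *ᵥ x) ⬝ᵥ (P *ᵥ (L *ᵥ x)) := by
  rw [Matrix.star_mulVec, ← Matrix.mulVec_mulVec, ← Matrix.mulVec_mulVec,
    ← Matrix.dotProduct_mulVec]

theorem jr_dim {ι κ κ' : Type*} [Fintype ι] [Fintype κ] [Fintype κ']
    (P : Matrix ι ι ℂ) (L1 : Matrix ι κ ℂ) (L2 : Matrix ι κ' ℂ)
    (h1 : (L1ᴴ * P * L1).PosDef) (h2 : (-(L2ᴴ * P * L2)).PosSemidef)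
    (hi : Function.Injective L2.mulVec) : Fintype.card κ + Fintype.card κ' ≤ Fintype.card ι := by
  have hinj : Function.Injective (Matrix.fromCols L1 L2).mulVecLin := by
    rw [injective_iff_map_eq_zero]
    intro v hv
    rw [Matrix.mulVecLin_apply, Matrix.fromCols_mulVec] at hv
    have hx : v ∘ Sum.inl = 0 := by
      by_contra hne
      have hp := h1.dotProduct_mulVec_pos hne
      have hn := h2.dotProduct_mulVec_nonneg (v ∘ Sum.inr)
      rw [Matrix.neg_mulVec, dotProduct_neg, jr_quad] at hn
      rw [jr_quad, eq_neg_of_add_eq_zero_left hv] at hp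
      simp only [star_neg, Matrix.mulVec_neg, dotProduct_neg, neg_dotProduct, neg_neg] at hp
      have := add_pos_of_pos_of_nonneg hp hn
      simp at this
    rw [hx, Matrix.mulVec_zero, zero_add] at hv
    have hy : v ∘ Sum.inr = 0 := hi (by simpa using hv)
    ext i
    rcases i with i | i
    · exact congrFun hx i
    · exact congrFun hy i
  have := LinearMap.finrank_le_finrank_of_injective hinj
  simpa using this

theorem jr_diag {ι : Type*} [Fintype ι] [DecidableEq ι] {P : Matrix ι ι ℂ} (hP : P.IsHermitian) :
    ∃ U : Matrix ι ι ℂ, Function.Injective U.mulVec ∧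
      Uᴴ * P * U = Matrix.diagonal (fun i => (hP.eigenvalues i : ℂ)) := by
  refine ⟨(hP.eigenvectorUnitary : Matrix ι ι ℂ), ?_, ?_⟩
  · intro x y h
    have h' := congrArg (fun z => (star (hP.eigenvectorUnitary : Matrix ι ι ℂ)) *ᵥ z) h
    simpa [Matrix.mulVec_mulVec] using h'
  · have := hP.conjStarAlgAut_star_eigenvectorUnitary
    rw [Unitary.conjStarAlgAut_apply] at this
    simp only [Unitary.coe_star, Matrix.star_eq_conjTranspose,
      Matrix.conjTranspose_conjTranspose] at this
    exact this

theorem jr_diag_sub {ι : Type*} [Fintype ι] [DecidableEq ι] {P : Matrix ι ι ℂ}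
    (hP : P.IsHermitian) (p : ι → Prop) [DecidablePred p] :
    ∃ L : Matrix ι {i // p i} ℂ, Function.Injective L.mulVec ∧
      Lᴴ * P * L = Matrix.diagonal (fun i : {i // p i} => (hP.eigenvalues i : ℂ)) := by
  obtain ⟨U, hU, hd⟩ := jr_diag hP
  refine ⟨U.submatrix id Subtype.val, ?_, ?_⟩
  · have : U.submatrix id (Subtype.val : {i // p i} → ι) =
        U * (1 : Matrix ι ι ℂ).submatrix id Subtype.val := by
      ext i j
      simp [Matrix.mul_apply, Matrix.one_apply]
    rw [this]
    intro x y h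
    simp only [← Matrix.mulVec_mulVec] at h
    have h' := hU h
    ext i
    have h'' := congrFun h' i.1
    simpa [Matrix.mulVec, dotProduct, Matrix.one_apply, Subtype.val_inj] using h''
  · have : (U.submatrix id (Subtype.val : {i // p i} → ι))ᴴ * P *
        U.submatrix id (Subtype.val : {i // p i} → ι) =
        (Uᴴ * P * U).submatrix Subtype.val (Subtype.val : {i // p i} → ι) := by
      ext i j
      simp [Matrix.mul_apply]
    rw [this, hd]
    ext i j
    simp [Matrix.diagonal_apply, Subtype.val_inj]

theorem jr_exists_neg {ι : Type*} [Fintype ι] [DecidableEq ι] {P : Matrix ι ι ℂ}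
    (hP : P.IsHermitian) :
    ∃ L : Matrix ι {i // hP.eigenvalues i < 0} ℂ, (-(Lᴴ * P * L)).PosDef := by
  obtain ⟨L, -, h⟩ := jr_diag_sub hP (fun i => hP.eigenvalues i < 0)
  refine ⟨L, ?_⟩
  rw [h, Matrix.diagonal_neg, Matrix.posDef_diagonal_iff]
  intro i
  have := i.2
  rw [← Complex.ofReal_neg]
  exact_mod_cast neg_pos.2 this

theorem jr_exists_pos {ι : Type*} [Fintype ι] [DecidableEq ι] {P : Matrix ι ι ℂ}
    (hP : P.IsHermitian) :
    ∃ L : Matrix ι {i // 0 < hP.eigenvalues i} ℂ, (Lᴴ * P * L).PosDef := by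
  obtain ⟨L, -, h⟩ := jr_diag_sub hP (fun i => 0 < hP.eigenvalues i)
  refine ⟨L, ?_⟩
  rw [h, Matrix.posDef_diagonal_iff]
  intro i
  have := i.2
  exact_mod_cast this

theorem jr_pos_le {ι κ : Type*} [Fintype ι] [DecidableEq ι] [Fintype κ] {P : Matrix ι ι ℂ}
    (hP : P.IsHermitian) (L : Matrix ι κ ℂ) (h : (Lᴴ * P * L).PosDef) :
    Fintype.card κ ≤ posCount hP := by
  obtain ⟨L2, hi, h2⟩ := jr_diag_sub hP (fun i => ¬ 0 < hP.eigenvalues i)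
  have := jr_dim P L L2 h (by
    rw [h2, Matrix.diagonal_neg, Matrix.posSemidef_diagonal_iff]
    intro i
    have := not_lt.1 i.2
    rw [← Complex.ofReal_neg]
    exact_mod_cast neg_nonneg.2 this) hi
  rw [Fintype.card_subtype_compl] at this
  have h3 := Fintype.card_subtype_le (fun i => 0 < hP.eigenvalues i)
  unfold posCount
  omega

theorem jr_neg_le {ι κ : Type*} [Fintype ι] [DecidableEq ι] [Fintype κ] {P : Matrix ι ι ℂ}
    (hP : P.IsHermitian) (L : Matrix ι κ ℂ) (h : (-(Lᴴ * P * L)).PosDef) :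
    Fintype.card κ ≤ negCount hP := by
  obtain ⟨L2, hi, h2⟩ := jr_diag_sub hP (fun i => ¬ hP.eigenvalues i < 0)
  have := jr_dim (-P) L L2 (by simpa using h) (by
    rw [Matrix.mul_neg, Matrix.neg_mul, neg_neg, h2, Matrix.posSemidef_diagonal_iff]
    intro i
    have := not_lt.1 i.2
    exact_mod_cast this) hi
  rw [Fintype.card_subtype_compl] at this
  have h3 := Fintype.card_subtype_le (fun i => hP.eigenvalues i < 0)
  unfold negCount
  omega

theorem jr_count {ι : Type*} [Fintype ι] [DecidableEq ι] {P : Matrix ι ι ℂ}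
    (hP : P.IsHermitian) : posCount hP + negCount hP + zeroCount hP = Fintype.card ι := by
  classical
  unfold posCount negCount zeroCount
  simp only [Fintype.card_subtype]
  rw [← Finset.card_univ, ← Finset.card_union_of_disjoint, ← Finset.card_union_of_disjoint]
  · congr 1
    ext i
    simp only [Finset.mem_union, Finset.mem_filter, Finset.mem_univ, true_and, iff_true]
    rcases lt_trichotomy (hP.eigenvalues i) 0 with h | h | h <;> tauto
  · rw [Finset.disjoint_left]
    intro i
    simp only [Finset.mem_union, Finset.mem_filter, Finset.mem_univ, true_and]
    rintro (h | h)
    · exact h.ne'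
    · exact h.ne
  · rw [Finset.disjoint_left]
    intro i
    simp only [Finset.mem_filter, Finset.mem_univ, true_and]
    exact fun h h' => lt_asymm h h'

theorem jr_det {ι : Type*} [Fintype ι] [DecidableEq ι] {P : Matrix ι ι ℂ}
    (hP : P.IsHermitian) : P.det ≠ 0 ↔ posCount hP + negCount hP = Fintype.card ι := by
  have h := jr_count hP
  have : P.det ≠ 0 ↔ zeroCount hP = 0 := by
    rw [hP.det_eq_prod_eigenvalues, Finset.prod_ne_zero_iff, zeroCount, Fintype.card_eq_zero_iff,
      isEmpty_subtype]
    simp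
  rw [this]
  omega

theorem jr_bd {κ : Type*} [Fintype κ] [DecidableEq κ] {H : Matrix κ κ ℂ} (hH : H.IsHermitian)
    (c : ℝ) (hc : ∀ i, c ≤ hH.eigenvalues i) : (H - (c : ℂ) • (1 : Matrix κ κ ℂ)).PosSemidef := by
  have h := hH.conjStarAlgAut_star_eigenvectorUnitary
  rw [Unitary.conjStarAlgAut_apply] at h
  simp only [Unitary.coe_star, star_star] at h
  have hu : IsUnit (hH.eigenvectorUnitary : Matrix κ κ ℂ) := Unitary.isUnit_coe
  rw [← hu.posSemidef_star_left_conjugate_iff, Matrix.mul_sub, Matrix.sub_mul, h]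
  simp only [Matrix.mul_smul, Matrix.smul_mul, Matrix.mul_one, Unitary.coe_star_mul_self]
  rw [Matrix.smul_one_eq_diagonal, Matrix.diagonal_sub, Matrix.posSemidef_diagonal_iff]
  intro i
  have := sub_nonneg.2 (hc i)
  have h2 : (0 : ℂ) ≤ ((hH.eigenvalues i - c : ℝ) : ℂ) := by exact_mod_cast this
  rw [Complex.ofReal_sub] at h2
  exact h2

theorem jr_small {κ : Type*} [Fintype κ] {B C : Matrix κ κ ℂ} (hB : B.PosDef)
    (hC : C.IsHermitian) : ∃ ε : ℝ, 0 < ε ∧ (B - (ε : ℂ) • C).PosDef := by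
  classical
  obtain ⟨l, hl0, hl⟩ : ∃ l : ℝ, 0 < l ∧ ∀ i, l ≤ hB.1.eigenvalues i := by
    rcases isEmpty_or_nonempty κ with h | h
    · exact ⟨1, one_pos, fun i => (h.false i).elim⟩
    · obtain ⟨i, hi⟩ := Finite.exists_min hB.1.eigenvalues
      exact ⟨_, hB.eigenvalues_pos i, hi⟩
  obtain ⟨M, hM0, hM⟩ : ∃ M : ℝ, 0 ≤ M ∧ ∀ i, -M ≤ hC.neg.eigenvalues i := by
    refine ⟨∑ i, |hC.neg.eigenvalues i|, Finset.sum_nonneg fun i _ => abs_nonneg _, fun i => ?_⟩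
    have h1 := Finset.single_le_sum (f := fun i => |hC.neg.eigenvalues i|)
      (fun i _ => abs_nonneg _) (Finset.mem_univ i)
    have h2 := neg_abs_le (hC.neg.eigenvalues i)
    linarith
  have h1 := jr_bd hB.1 l hl
  have h2 := jr_bd hC.neg (-M) hM
  have he : 0 < l / (M + 1) := by positivity
  refine ⟨l / (M + 1), he, ?_⟩
  have h3 : 0 < l - l / (M + 1) * M := by
    have : l - l / (M + 1) * M = l / (M + 1) := by field_simp; ring
    rw [this]; exact he
  have h2' := h2.smul (a := ((l / (M + 1) : ℝ) : ℂ)) (by exact_mod_cast he.le)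
  have h3' := (Matrix.PosDef.one (n := κ) (R := ℂ)).smul
    (a := ((l - l / (M + 1) * M : ℝ) : ℂ)) (by exact_mod_cast h3)
  have := h3'.add_posSemidef (h1.add h2')
  convert this using 1
  push_cast
  module

theorem jr_gram_cols {ι κ κ' : Type*} [Fintype ι] (P : Matrix ι ι ℂ) (V : Matrix ι κ ℂ)
    (u : Matrix ι κ' ℂ) : (Matrix.fromCols V u)ᴴ * P * Matrix.fromCols V u =
      Matrix.fromBlocks (Vᴴ * P * V) (Vᴴ * P * u) (uᴴ * P * V) (uᴴ * P * u) := by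
  rw [Matrix.conjTranspose_fromCols_eq_fromRows_conjTranspose, Matrix.fromRows_mul,
    Matrix.fromRows_mul_fromCols]

theorem jr_herm {ι κ : Type*} [Fintype ι] {P : Matrix ι ι ℂ} (hP : P.IsHermitian)
    (V : Matrix ι κ ℂ) : (Vᴴ * P * V).IsHermitian :=
  Matrix.isHermitian_conjTranspose_mul_mul V hP

theorem jr_unit {Y : Matrix Unit Unit ℂ} (hY : Y.IsHermitian) :
    Y = (((Y () ()).re : ℝ) : ℂ) • (1 : Matrix Unit Unit ℂ) := by
  ext i j
  have := hY.coe_re_apply_self ()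
  simpa using this.symm

theorem jr_inj {ι κ : Type*} [Fintype ι] [Fintype κ] (V : Matrix ι κ ℂ) (u : Matrix ι Unit ℂ)
    (r : Matrix Unit ι ℂ) (hV : Function.Injective V.mulVec) (h0 : r * V = 0) (h1 : r * u ≠ 0) :
    Function.Injective (Matrix.fromCols V u).mulVec := by
  have : Function.Injective (Matrix.fromCols V u).mulVecLin := by
    rw [injective_iff_map_eq_zero]
    intro v hv
    rw [Matrix.mulVecLin_apply, Matrix.fromCols_mulVec] at hv
    have h2 := congrArg (fun z => r *ᵥ z) hv
    simp only [Matrix.mulVec_add, Matrix.mulVec_mulVec, h0, Matrix.zero_mulVec, zero_add,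
      Matrix.mulVec_zero] at h2
    have h3 := congrFun h2 ()
    simp only [Matrix.mulVec, dotProduct, Finset.univ_unique, Finset.sum_singleton,
      Function.comp, Pi.zero_apply, mul_eq_zero] at h3
    have h4 : (r * u) () () ≠ 0 := fun h => h1 (by ext i j; exact h)
    have hy : v ∘ Sum.inr = 0 := by
      ext i
      exact h3.resolve_left h4
    rw [hy, Matrix.mulVec_zero, add_zero] at hv
    have hx : v ∘ Sum.inl = 0 := hV (by simpa using hv)
    ext i
    rcases i with i | i
    · exact congrFun hx i
    · exact congrFun hy i
  exact this

theorem jr_blk {κ κ' : Type*} [Fintype κ] [Fintype κ'] {A : Matrix κ κ ℂ} {D : Matrix κ' κ' ℂ}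
    (hA : A.PosDef) (hD : D.PosDef) : (Matrix.fromBlocks A 0 0 D).PosDef := by
  refine Matrix.PosDef.of_dotProduct_mulVec_pos
    (Matrix.IsHermitian.fromBlocks hA.1 (by simp) hD.1) ?_
  intro v hv
  have : star v ⬝ᵥ (Matrix.fromBlocks A 0 0 D *ᵥ v) =
      star (v ∘ Sum.inl) ⬝ᵥ (A *ᵥ (v ∘ Sum.inl)) + star (v ∘ Sum.inr) ⬝ᵥ (D *ᵥ (v ∘ Sum.inr)) := by
    rw [Matrix.fromBlocks_mulVec]
    simp [dotProduct, Fintype.sum_sum_type]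
  rw [this]
  by_cases hx : v ∘ Sum.inl = 0
  · have hy : v ∘ Sum.inr ≠ 0 := by
      intro hy
      apply hv
      ext i
      rcases i with i | i
      · exact congrFun hx i
      · exact congrFun hy i
    exact add_pos_of_nonneg_of_pos (hA.posSemidef.dotProduct_mulVec_nonneg _)
      (hD.dotProduct_mulVec_pos hy)
  · exact add_pos_of_pos_of_nonneg (hA.dotProduct_mulVec_pos hx)
      (hD.posSemidef.dotProduct_mulVec_nonneg _)

theorem jr_notpsd {ι : Type*} [Fintype ι] {X : Matrix ι ι ℂ} (hX : X.IsHermitian)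
    (hn : ¬ X.PosSemidef) : ∃ (x : Matrix ι Unit ℂ) (c : ℝ), 0 < c ∧
      xᴴ * X * x = (-(c : ℂ)) • (1 : Matrix Unit Unit ℂ) := by
  by_contra hcon
  push Not at hcon
  apply hn
  refine Matrix.PosSemidef.of_dotProduct_mulVec_nonneg hX fun x => ?_
  have h1 := jr_unit (jr_herm hX (Matrix.replicateCol Unit x))
  have h2 : star x ⬝ᵥ (X *ᵥ x) =
      ((Matrix.replicateCol Unit x)ᴴ * X * (Matrix.replicateCol Unit x)) () () := by
    rw [Matrix.mul_assoc]
    rfl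
  set Y := (Matrix.replicateCol Unit x)ᴴ * X * (Matrix.replicateCol Unit x)
  by_cases hlt : (Y () ()).re < 0
  · have h3 : Y = (-(((-(Y () ()).re : ℝ)) : ℂ)) • (1 : Matrix Unit Unit ℂ) := by
      rw [Complex.ofReal_neg, neg_neg]; exact h1
    exact absurd h3 (hcon _ _ (by linarith))
  · rw [h2, h1]
    have : (0 : ℂ) ≤ (((Y () ()).re : ℝ) : ℂ) := by exact_mod_cast not_lt.1 hlt
    simpa using this

theorem jr_proj {ι κ : Type*} [Fintype ι] [DecidableEq ι] [Fintype κ] [DecidableEq κ]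
    {Q : Matrix ι ι ℂ} (hQ : Q.IsHermitian) (V : Matrix ι κ ℂ) (g : Matrix κ κ ℂ)
    (hg : Vᴴ * Q * V = g) (hd : g.det ≠ 0) :
    Vᴴ * Q * (1 - V * g⁻¹ * Vᴴ * Q) = 0 ∧
    (1 - V * g⁻¹ * Vᴴ * Q)ᴴ * Q * (1 - V * g⁻¹ * Vᴴ * Q) = Q - Q * V * g⁻¹ * Vᴴ * Q := by
  have hu : IsUnit g.det := isUnit_iff_ne_zero.2 hd
  have h1 : Vᴴ * Q * (1 - V * g⁻¹ * Vᴴ * Q) = 0 := by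
    have : Vᴴ * Q * (V * g⁻¹ * Vᴴ * Q) = (Vᴴ * Q * V) * g⁻¹ * (Vᴴ * Q) := by
      simp only [Matrix.mul_assoc]
    rw [Matrix.mul_sub, this, hg, Matrix.mul_nonsing_inv _ hu]
    simp
  refine ⟨h1, ?_⟩
  have h2 : (1 - V * g⁻¹ * Vᴴ * Q)ᴴ = 1 - Q * V * g⁻¹ᴴ * Vᴴ := by
    rw [Matrix.conjTranspose_sub]
    simp only [Matrix.conjTranspose_mul, Matrix.conjTranspose_one,
      Matrix.conjTranspose_conjTranspose, hQ.eq, Matrix.mul_assoc]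
  rw [h2, Matrix.mul_assoc, Matrix.sub_mul, Matrix.one_mul]
  have h3 : Q * V * g⁻¹ᴴ * Vᴴ * (Q * (1 - V * g⁻¹ * Vᴴ * Q)) =
      Q * V * g⁻¹ᴴ * (Vᴴ * Q * (1 - V * g⁻¹ * Vᴴ * Q)) := by
    simp only [Matrix.mul_assoc]
  rw [h3, h1, Matrix.mul_zero, sub_zero, Matrix.mul_sub, Matrix.mul_one]
  simp only [Matrix.mul_assoc]

theorem jr_solve {ι κ μ : Type*} [Fintype ι] [DecidableEq ι] [Fintype κ] [DecidableEq κ]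
    {P : Matrix ι ι ℂ} (hd : P.det ≠ 0) (V : Matrix ι κ ℂ) (hV : Function.Injective V.mulVec)
    (y : Matrix κ μ ℂ) : ∃ t : Matrix ι μ ℂ, Vᴴ * P * t = y := by
  have hpd : (Vᴴ * V).PosDef := Matrix.PosDef.conjTranspose_mul_self V hV
  have hu : IsUnit (Vᴴ * V).det := isUnit_iff_ne_zero.2 hpd.det_pos.ne'
  refine ⟨P⁻¹ * (V * ((Vᴴ * V)⁻¹ * y)), ?_⟩
  have : Vᴴ * P * (P⁻¹ * (V * ((Vᴴ * V)⁻¹ * y))) =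
      Vᴴ * (P * P⁻¹) * (V * ((Vᴴ * V)⁻¹ * y)) := by simp only [Matrix.mul_assoc]
  rw [this, Matrix.mul_nonsing_inv _ (isUnit_iff_ne_zero.2 hd), Matrix.mul_one,
    ← Matrix.mul_assoc, ← Matrix.mul_assoc, Matrix.mul_nonsing_inv _ hu, Matrix.one_mul]

theorem jr_stepA {α β σ : Type*} [Fintype α] [DecidableEq α] [Fintype β] [DecidableEq β]
    [Fintype σ] [DecidableEq σ] {P : Matrix α α ℂ} {Q : Matrix β β ℂ} (hP : P.IsHermitian)
    (hQ : Q.IsHermitian) (dP : P.det ≠ 0) (dQ : Q.det ≠ 0) (V1 : Matrix α σ ℂ)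
    (V2 : Matrix β σ ℂ) (i1 : Function.Injective V1.mulVec) (i2 : Function.Injective V2.mulVec)
    (hg : V1ᴴ * P * V1 = V2ᴴ * Q * V2) (hd : (V2ᴴ * Q * V2).det = 0) :
    ∃ (t : Matrix α Unit ℂ) (u : Matrix β Unit ℂ),
      Function.Injective (Matrix.fromCols V1 t).mulVec ∧
      Function.Injective (Matrix.fromCols V2 u).mulVec ∧
      V1ᴴ * P * t = V2ᴴ * Q * u ∧ tᴴ * P * t = uᴴ * Q * u := by
  obtain ⟨c0, hc0, hgc0⟩ := Matrix.exists_mulVec_eq_zero_iff.2 hd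
  set c : Matrix σ Unit ℂ := Matrix.replicateCol Unit c0 with hc
  have hgc : (V2ᴴ * Q * V2) * c = 0 := by
    ext i j
    exact congrFun hgc0 i
  have hgc' : cᴴ * (V2ᴴ * Q * V2) = 0 := by
    have := congrArg Matrix.conjTranspose hgc
    rwa [Matrix.conjTranspose_mul, (jr_herm hQ V2).eq, Matrix.conjTranspose_zero] at this
  set u : Matrix β Unit ℂ := Q * (V2 * c) with hu
  have hune : u ≠ 0 := by
    intro h
    have h1 : V2 *ᵥ c0 = 0 := by
      apply Matrix.eq_zero_of_mulVec_eq_zero dQ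
      ext i
      exact congrFun (congrFun h i) ()
    exact hc0 (i2 (by simpa using h1))
  have hR : (V2 * c)ᴴ * Q * u = uᴴ * u := by
    rw [hu, Matrix.conjTranspose_mul Q, hQ.eq]
  have hRne : uᴴ * u ≠ 0 := by
    intro h
    exact hune (Matrix.conjTranspose_mul_self_eq_zero.1 h)
  obtain ⟨t0, ht0⟩ := jr_solve dP V1 i1 (V2ᴴ * Q * u)
  have hRherm : (uᴴ * u).IsHermitian := Matrix.isHermitian_conjTranspose_mul_self u
  have hRu := jr_unit hRherm
  set ρ : ℝ := ((uᴴ * u) () ()).re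
  have hρ : ρ ≠ 0 := by
    intro h
    rw [h] at hRu
    apply hRne
    rw [hRu]; simp
  have ha := jr_unit (jr_herm hQ u)
  have hb := jr_unit (jr_herm hP t0)
  set a : ℝ := ((uᴴ * Q * u) () ()).re
  set b : ℝ := ((t0ᴴ * P * t0) () ()).re
  set k : ℝ := (a - b) / (2 * ρ) with hk
  have hct : (V1 * c)ᴴ * P * t0 = uᴴ * u := by
    rw [← hR, Matrix.conjTranspose_mul, Matrix.conjTranspose_mul, Matrix.mul_assoc,
      Matrix.mul_assoc, ← Matrix.mul_assoc V1ᴴ, ht0]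
    simp only [Matrix.mul_assoc]
  have htc : t0ᴴ * P * (V1 * c) = uᴴ * u := by
    have := congrArg Matrix.conjTranspose hct
    rw [hRherm.eq] at this
    rw [← this]
    simp only [Matrix.conjTranspose_mul, Matrix.conjTranspose_conjTranspose, hP.eq,
      Matrix.mul_assoc]
  have hVc : V1ᴴ * P * (V1 * c) = 0 := by
    rw [← Matrix.mul_assoc, hg, hgc]
  have hcc : (V1 * c)ᴴ * P * (V1 * c) = 0 := by
    rw [Matrix.conjTranspose_mul, Matrix.mul_assoc, Matrix.mul_assoc, ← Matrix.mul_assoc V1ᴴ, hVc,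
      Matrix.mul_zero]
  have hVt : V1ᴴ * P * (t0 + (k : ℂ) • (V1 * c)) = V2ᴴ * Q * u := by
    rw [Matrix.mul_add, Matrix.mul_smul, hVc, ht0, smul_zero, add_zero]
  refine ⟨t0 + (k : ℂ) • (V1 * c), u, ?_, ?_, hVt, ?_⟩
  · refine jr_inj _ _ ((V1 * c)ᴴ * P) i1 ?_ ?_
    · rw [Matrix.conjTranspose_mul, Matrix.mul_assoc, Matrix.mul_assoc, ← Matrix.mul_assoc V1ᴴ,
        hg, hgc']
    · rw [Matrix.mul_add, hct, Matrix.mul_smul, hcc, smul_zero, add_zero]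
      exact hRne
  · refine jr_inj _ _ ((V2 * c)ᴴ * Q) i2 ?_ ?_
    · rw [Matrix.conjTranspose_mul, Matrix.mul_assoc, Matrix.mul_assoc, ← Matrix.mul_assoc V2ᴴ,
        hgc']
    · rw [hR]; exact hRne
  · rw [Matrix.conjTranspose_add, Matrix.conjTranspose_smul, Matrix.add_mul, Matrix.add_mul,
      Matrix.mul_add, Matrix.mul_add]
    simp only [Matrix.smul_mul, Matrix.mul_smul, hct, htc, hcc]
    rw [ha, hb, hRu]
    have hkk : b + 2 * k * ρ = a := by rw [hk]; field_simp; ring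
    rw [← hkk]
    simp only [Complex.star_def, Complex.conj_ofReal]
    push_cast
    module

theorem jr_stepB {α β σ : Type*} [Fintype α] [DecidableEq α] [Fintype β] [DecidableEq β]
    [Fintype σ] [DecidableEq σ] {P : Matrix α α ℂ} {Q : Matrix β β ℂ} (hP : P.IsHermitian)
    (hQ : Q.IsHermitian) (hle : negCount hQ ≤ negCount hP) (V1 : Matrix α σ ℂ)
    (V2 : Matrix β σ ℂ) (i1 : Function.Injective V1.mulVec) (i2 : Function.Injective V2.mulVec)
    (hg : V1ᴴ * P * V1 = V2ᴴ * Q * V2) (hd : (V2ᴴ * Q * V2).det ≠ 0)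
    (hno : ¬ ∃ W : Matrix α β ℂ, W * V2 = V1 ∧ (Q - Wᴴ * P * W).PosSemidef) :
    ∃ (t : Matrix α Unit ℂ) (u : Matrix β Unit ℂ),
      Function.Injective (Matrix.fromCols V1 t).mulVec ∧
      Function.Injective (Matrix.fromCols V2 u).mulVec ∧
      V1ᴴ * P * t = V2ᴴ * Q * u ∧ tᴴ * P * t = uᴴ * Q * u := by
  have hgh := jr_herm hQ V2
  set g := V2ᴴ * Q * V2 with hgdef
  have hu : IsUnit g.det := isUnit_iff_ne_zero.2 hd
  have hgi : g⁻¹ᴴ = g⁻¹ := by rw [Matrix.conjTranspose_nonsing_inv, hgh.eq]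
  obtain ⟨q1, q2⟩ := jr_proj hQ V2 g hgdef.symm hd
  obtain ⟨p1, p2⟩ := jr_proj hP V1 g hg hd
  set Rq := 1 - V2 * g⁻¹ * V2ᴴ * Q
  set Rp := 1 - V1 * g⁻¹ * V1ᴴ * P
  -- negative vector in the complement in the second space
  have hnq : ¬ (Rqᴴ * Q * Rq).PosSemidef := by
    intro hpsd
    apply hno
    refine ⟨V1 * g⁻¹ * V2ᴴ * Q, ?_, ?_⟩
    · have : V1 * g⁻¹ * V2ᴴ * Q * V2 = V1 * (g⁻¹ * (V2ᴴ * Q * V2)) := by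
        simp only [Matrix.mul_assoc]
      rw [this, ← hgdef, Matrix.nonsing_inv_mul _ hu, Matrix.mul_one]
    · have : (V1 * g⁻¹ * V2ᴴ * Q)ᴴ * P * (V1 * g⁻¹ * V2ᴴ * Q) =
          Q * V2 * g⁻¹ * V2ᴴ * Q := by
        have e1 : (V1 * g⁻¹ * V2ᴴ * Q)ᴴ = Q * V2 * g⁻¹ * V1ᴴ := by
          simp only [Matrix.conjTranspose_mul, Matrix.conjTranspose_conjTranspose, hQ.eq, hgi,
            Matrix.mul_assoc]
        have e2 : Q * V2 * g⁻¹ * V1ᴴ * P * (V1 * g⁻¹ * V2ᴴ * Q) =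
            Q * V2 * (g⁻¹ * (V1ᴴ * P * V1)) * g⁻¹ * V2ᴴ * Q := by
          simp only [Matrix.mul_assoc]
        rw [e1, e2, hg, Matrix.nonsing_inv_mul _ hu, Matrix.mul_one]
      rw [this, ← q2]
      exact hpsd
  obtain ⟨x, c, hc, hx⟩ := jr_notpsd (jr_herm hQ Rq) hnq
  set e := Rq * x with he
  have he1 : V2ᴴ * Q * e = 0 := by rw [he, ← Matrix.mul_assoc, q1, Matrix.zero_mul]
  have he1' : eᴴ * Q * V2 = 0 := by
    have := congrArg Matrix.conjTranspose he1
    simpa only [Matrix.conjTranspose_mul, Matrix.conjTranspose_conjTranspose, hQ.eq,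
      Matrix.conjTranspose_zero, ← Matrix.mul_assoc] using this
  have he2 : eᴴ * Q * e = (-(c : ℂ)) • (1 : Matrix Unit Unit ℂ) := by
    rw [← hx, he, Matrix.conjTranspose_mul]
    simp only [Matrix.mul_assoc]
  have hnp : ¬ (Rpᴴ * P * Rp).PosSemidef := by
    intro hpsd
    obtain ⟨N, hN⟩ := jr_exists_neg hP
    set Y := g⁻¹ * V1ᴴ * P * N with hY
    have hYg : Yᴴ * g * Y = Nᴴ * (P * V1 * g⁻¹ * V1ᴴ * P) * N := by
      have e1 : Yᴴ = Nᴴ * P * V1 * g⁻¹ := by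
        simp only [hY, Matrix.conjTranspose_mul, Matrix.conjTranspose_conjTranspose, hP.eq, hgi,
          Matrix.mul_assoc]
      have e2 : Nᴴ * P * V1 * g⁻¹ * g * (g⁻¹ * V1ᴴ * P * N) =
          Nᴴ * P * V1 * (g⁻¹ * g) * (g⁻¹ * V1ᴴ * P * N) := by simp only [Matrix.mul_assoc]
      rw [e1, hY, e2, Matrix.nonsing_inv_mul _ hu, Matrix.mul_one]
      simp only [Matrix.mul_assoc]
    have hYneg : (-(Yᴴ * g * Y)).PosDef := by
      have h1 := hN.add_posSemidef (hpsd.conjTranspose_mul_mul_same N)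
      rw [p2, Matrix.mul_sub, Matrix.sub_mul, ← hYg] at h1
      convert h1 using 1
      abel
    have hL : (-((Matrix.fromCols (V2 * Y) e)ᴴ * Q * Matrix.fromCols (V2 * Y) e)).PosDef := by
      have e1 : (V2 * Y)ᴴ * Q * (V2 * Y) = Yᴴ * g * Y := by
        rw [hgdef, Matrix.conjTranspose_mul]; simp only [Matrix.mul_assoc]
      have e2 : (V2 * Y)ᴴ * Q * e = 0 := by
        rw [Matrix.conjTranspose_mul, Matrix.mul_assoc, Matrix.mul_assoc, ← Matrix.mul_assoc V2ᴴ,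
          he1, Matrix.mul_zero]
      have e3 : eᴴ * Q * (V2 * Y) = 0 := by
        rw [← Matrix.mul_assoc, he1', Matrix.zero_mul]
      rw [jr_gram_cols, e1, e2, e3, he2, Matrix.fromBlocks_neg, neg_zero, neg_zero]
      refine jr_blk hYneg ?_
      rw [neg_smul, neg_neg]
      exact (Matrix.PosDef.one (n := Unit) (R := ℂ)).smul (by exact_mod_cast hc)
    have h1 := jr_neg_le hQ _ hL
    rw [Fintype.card_sum, Fintype.card_unit] at h1
    unfold negCount at h1 hle
    omega
  obtain ⟨y, d, hd0, hy⟩ := jr_notpsd (jr_herm hP Rp) hnp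
  set f := Rp * y with hf
  have hf1 : V1ᴴ * P * f = 0 := by rw [hf, ← Matrix.mul_assoc, p1, Matrix.zero_mul]
  have hf1' : fᴴ * P * V1 = 0 := by
    have := congrArg Matrix.conjTranspose hf1
    simpa only [Matrix.conjTranspose_mul, Matrix.conjTranspose_conjTranspose, hP.eq,
      Matrix.conjTranspose_zero, ← Matrix.mul_assoc] using this
  have hf2 : fᴴ * P * f = (-(d : ℂ)) • (1 : Matrix Unit Unit ℂ) := by
    rw [← hy, hf, Matrix.conjTranspose_mul]
    simp only [Matrix.mul_assoc]
  have hs0 : 0 < Real.sqrt (c / d) := Real.sqrt_pos.2 (by positivity)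
  have hs : Real.sqrt (c / d) * Real.sqrt (c / d) * d = c := by
    rw [Real.mul_self_sqrt (by positivity)]; field_simp
  set s := Real.sqrt (c / d)
  refine ⟨(s : ℂ) • f, e, ?_, ?_, ?_, ?_⟩
  · refine jr_inj _ _ (fᴴ * P) i1 hf1' ?_
    rw [Matrix.mul_smul, hf2]
    intro h
    have := congrFun (congrFun h ()) ()
    simp at this
    rcases this with h | h
    · exact hs0.ne' h
    · exact hd0.ne' h
  · refine jr_inj _ _ (eᴴ * Q) i2 he1' ?_
    rw [he2]
    intro h
    have := congrFun (congrFun h ()) ()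
    simp at this
    exact hc.ne' this
  · rw [Matrix.mul_smul, hf1, he1, smul_zero]
  · rw [Matrix.conjTranspose_smul, Matrix.smul_mul, Matrix.smul_mul, Matrix.mul_smul, hf2, he2,
      ← hs]
    simp only [Complex.star_def, Complex.conj_ofReal]
    push_cast
    module

theorem jr_core {α β : Type} [Fintype α] [DecidableEq α] [Fintype β] [DecidableEq β]
    {P : Matrix α α ℂ} {Q : Matrix β β ℂ} (hP : P.IsHermitian)
    (hQ : Q.IsHermitian) (dP : P.det ≠ 0) (dQ : Q.det ≠ 0) (hle : negCount hQ ≤ negCount hP)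
    (k : ℕ) : ∀ (σ : Type) [Fintype σ] [DecidableEq σ] (V1 : Matrix α σ ℂ)
    (V2 : Matrix β σ ℂ), Fintype.card β ≤ Fintype.card σ + k →
    Function.Injective V1.mulVec → Function.Injective V2.mulVec →
    V1ᴴ * P * V1 = V2ᴴ * Q * V2 →
    ∃ W : Matrix α β ℂ, W * V2 = V1 ∧ (Q - Wᴴ * P * W).PosSemidef := by
  induction k with
  | zero =>
    intro σ _ _ V1 V2 hk i1 i2 hg
    by_contra hno
    obtain ⟨t, u, it, iu, h1, h2⟩ : ∃ (t : Matrix α Unit ℂ) (u : Matrix β Unit ℂ),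
      Function.Injective (Matrix.fromCols V1 t).mulVec ∧
      Function.Injective (Matrix.fromCols V2 u).mulVec ∧
      V1ᴴ * P * t = V2ᴴ * Q * u ∧ tᴴ * P * t = uᴴ * Q * u := by
      by_cases hd : (V2ᴴ * Q * V2).det = 0
      · exact jr_stepA hP hQ dP dQ V1 V2 i1 i2 hg hd
      · exact jr_stepB hP hQ hle V1 V2 i1 i2 hg hd hno
    have hi : Function.Injective (Matrix.fromCols V2 u).mulVecLin := iu
    have := LinearMap.finrank_le_finrank_of_injective hi
    simp at this
    omega
  | succ k ih =>
    intro σ _ _ V1 V2 hk i1 i2 hg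
    by_contra hno
    obtain ⟨t, u, it, iu, h1, h2⟩ : ∃ (t : Matrix α Unit ℂ) (u : Matrix β Unit ℂ),
      Function.Injective (Matrix.fromCols V1 t).mulVec ∧
      Function.Injective (Matrix.fromCols V2 u).mulVec ∧
      V1ᴴ * P * t = V2ᴴ * Q * u ∧ tᴴ * P * t = uᴴ * Q * u := by
      by_cases hd : (V2ᴴ * Q * V2).det = 0
      · exact jr_stepA hP hQ dP dQ V1 V2 i1 i2 hg hd
      · exact jr_stepB hP hQ hle V1 V2 i1 i2 hg hd hno
    have h1' : tᴴ * P * V1 = uᴴ * Q * V2 := by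
      have := congrArg Matrix.conjTranspose h1
      simpa only [Matrix.conjTranspose_mul, Matrix.conjTranspose_conjTranspose, hP.eq, hQ.eq,
        ← Matrix.mul_assoc] using this
    obtain ⟨W, hW, hpsd⟩ := ih (σ ⊕ Unit) (Matrix.fromCols V1 t) (Matrix.fromCols V2 u)
      (by rw [Fintype.card_sum, Fintype.card_unit]; omega) it iu
      (by rw [jr_gram_cols, jr_gram_cols, hg, h1, h2, h1'])
    refine hno ⟨W, ?_, hpsd⟩
    rw [Matrix.mul_fromCols] at hW
    exact (Matrix.fromCols_inj hW).1

theorem jr_perturb {ι : Type*} [Fintype ι] [DecidableEq ι] {Q C : Matrix ι ι ℂ}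
    (hQ : Q.IsHermitian) (dQ : Q.det ≠ 0) (hC : C.PosSemidef) :
    ∃ ε : ℝ, 0 < ε ∧ ∃ h : (Q - (ε : ℂ) • C).IsHermitian, (Q - (ε : ℂ) • C).det ≠ 0 ∧
      negCount h = negCount hQ := by
  obtain ⟨L, hL⟩ := jr_exists_pos hQ
  obtain ⟨N, hN⟩ := jr_exists_neg hQ
  obtain ⟨ε, hε, h⟩ := jr_small hL (jr_herm hC.1 L)
  have hCs : ((ε : ℂ) • C).PosSemidef := hC.smul (by exact_mod_cast hε.le)
  have hH : (Q - (ε : ℂ) • C).IsHermitian := hQ.sub hCs.1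
  refine ⟨ε, hε, hH, ?_⟩
  have e1 : (Lᴴ * (Q - (ε : ℂ) • C) * L).PosDef := by
    rw [Matrix.mul_sub, Matrix.sub_mul, Matrix.mul_smul, Matrix.smul_mul]
    exact h
  have e2 : (-(Nᴴ * (Q - (ε : ℂ) • C) * N)).PosDef := by
    rw [Matrix.mul_sub, Matrix.sub_mul, neg_sub, sub_eq_neg_add]
    exact hN.add_posSemidef (hCs.conjTranspose_mul_mul_same N)
  have l1 := jr_pos_le hH L e1
  have l2 := jr_neg_le hH N e2
  have l3 := (jr_det hQ).1 dQ
  have l4 := jr_count hH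
  rw [jr_det hH]
  change posCount hQ ≤ _ at l1
  change negCount hQ ≤ _ at l2
  omega

theorem jr_sub {ι κ : Type*} [Fintype ι] [DecidableEq ι] (P : Matrix ι ι ℂ) (f : κ → ι) :
    ((1 : Matrix ι ι ℂ).submatrix id f)ᴴ * P * (1 : Matrix ι ι ℂ).submatrix id f =
      P.submatrix f f := by
  ext i j
  simp [Matrix.mul_apply, Matrix.one_apply]

theorem jr_sub_inj {ι κ : Type*} [Fintype ι] [DecidableEq ι] [Fintype κ] [DecidableEq κ]
    (f : κ → ι) (hf : Function.Injective f) :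
    Function.Injective ((1 : Matrix ι ι ℂ).submatrix id f).mulVec := by
  have h := jr_sub (1 : Matrix ι ι ℂ) f
  rw [Matrix.mul_one, Matrix.submatrix_one f hf] at h
  intro x y hxy
  have h' := congrArg (fun z => ((1 : Matrix ι ι ℂ).submatrix id f)ᴴ *ᵥ z) hxy
  simpa only [Matrix.mulVec_mulVec, h, Matrix.one_mulVec] using h'

theorem jr_glueW {α β σ : Type} [Fintype α] [DecidableEq α] [Fintype β] [DecidableEq β]
    [Fintype σ] [DecidableEq σ]
    {P : Matrix α α ℂ} {Q : Matrix β β ℂ} (hP : P.IsHermitian)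
    (hQ : Q.IsHermitian) (dP : P.det ≠ 0) (dQ : Q.det ≠ 0) (hle : negCount hQ ≤ negCount hP)
    (f : σ → α) (g : σ → β) (hf : Function.Injective f) (hg : Function.Injective g)
    (hPQ : P.submatrix f f = Q.submatrix g g) (p : β → Prop) [DecidablePred p]
    (hp : ∀ s, ¬ p (g s)) :
    ∃ W : Matrix α β ℂ, (∀ i s, W i (g s) = if i = f s then 1 else 0) ∧
      (∀ i s, (Q - Wᴴ * P * W) i (g s) = 0) ∧
      ((Q - Wᴴ * P * W).submatrix (Subtype.val : {b // p b} → β) Subtype.val).PosDef := by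
  have hC : (Matrix.diagonal (fun b => if p b then (1 : ℂ) else 0)).PosSemidef := by
    rw [Matrix.posSemidef_diagonal_iff]
    intro i
    split_ifs <;> simp
  obtain ⟨ε, hε, hH, dH, hn⟩ := jr_perturb hQ dQ hC
  set C := Matrix.diagonal (fun b => if p b then (1 : ℂ) else 0) with hCdef
  have hCg : ∀ i s, C i (g s) = 0 := by
    intro i s
    rw [hCdef, Matrix.diagonal_apply]
    split_ifs with h1 h2
    · rw [h1] at h2; exact absurd h2 (hp s)
    · rfl
    · rfl
  obtain ⟨W, hW, hpsd⟩ := jr_core hP hH dP dH (hn ▸ hle) (Fintype.card β) σ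
    ((1 : Matrix α α ℂ).submatrix id f) ((1 : Matrix β β ℂ).submatrix id g) (by omega)
    (jr_sub_inj f hf) (jr_sub_inj g hg) (by
      rw [jr_sub, jr_sub, hPQ]
      ext i j
      simp [hCg])
  have hWg : ∀ i s, W i (g s) = if i = f s then 1 else 0 := by
    intro i s
    have := congrFun (congrFun hW i) s
    simpa [Matrix.mul_apply, Matrix.one_apply] using this
  set D := Q - (ε : ℂ) • C - Wᴴ * P * W with hD
  have hDQ : Q - Wᴴ * P * W = D + (ε : ℂ) • C := by rw [hD]; abel
  have hWPW : ∀ s s', (Wᴴ * P * W) (g s) (g s') = P (f s) (f s') := by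
    intro s s'
    simp [Matrix.mul_apply, hWg]
  have hD0 : ∀ i s, D i (g s) = 0 := by
    intro i s
    have h1 : star (Pi.single (g s) (1 : ℂ)) ⬝ᵥ (D *ᵥ Pi.single (g s) 1) = 0 := by
      have : star (Pi.single (g s) (1 : ℂ) : β → ℂ) = Pi.single (g s) 1 := by
        rw [← Pi.single_star, star_one]
      rw [this, Matrix.mulVec_single_one, single_one_dotProduct]
      have e := congrFun (congrFun hPQ s) s
      simp only [Matrix.submatrix_apply] at e
      simp [hD, hWPW, e, hCg]
    rw [hpsd.dotProduct_mulVec_zero_iff, Matrix.mulVec_single_one] at h1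
    exact congrFun h1 i
  refine ⟨W, hWg, ?_, ?_⟩
  · intro i s
    rw [hDQ]
    simp [hD0, hCg]
  · rw [hDQ, Matrix.submatrix_add]
    refine Matrix.PosDef.posSemidef_add (hpsd.submatrix _) ?_
    have : ((ε : ℂ) • C).submatrix (Subtype.val : {b // p b} → β) Subtype.val =
        (ε : ℂ) • (1 : Matrix {b // p b} {b // p b} ℂ) := by
      ext i j
      simp only [Matrix.submatrix_apply, Matrix.smul_apply, hCdef, Matrix.diagonal_apply,
        Matrix.one_apply, i.2, if_true, Subtype.ext_iff]
    rw [this]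
    exact Matrix.PosDef.one.smul (by exact_mod_cast hε)

theorem jr_neg_sub {ι κ : Type*} [Fintype ι] [DecidableEq ι] [Fintype κ] [DecidableEq κ]
    {P : Matrix ι ι ℂ} {R : Matrix κ κ ℂ} (hP : P.IsHermitian) (hR : R.IsHermitian) (f : κ → ι)
    (h : P.submatrix f f = R) : negCount hR ≤ negCount hP := by
  obtain ⟨N, hN⟩ := jr_exists_neg hR
  have : (-(((1 : Matrix ι ι ℂ).submatrix id f * N)ᴴ * P *
      ((1 : Matrix ι ι ℂ).submatrix id f * N))).PosDef := by
    have e : (((1 : Matrix ι ι ℂ).submatrix id f * N)ᴴ * P *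
      ((1 : Matrix ι ι ℂ).submatrix id f * N)) = Nᴴ * (((1 : Matrix ι ι ℂ).submatrix id f)ᴴ * P *
        (1 : Matrix ι ι ℂ).submatrix id f) * N := by
      rw [Matrix.conjTranspose_mul]; simp only [Matrix.mul_assoc]
    rw [e, jr_sub, h]
    exact hN
  exact jr_neg_le hP _ this

theorem jr_block {α E : Type*} [Fintype α] [DecidableEq α] [Fintype E] [DecidableEq E]
    {P : Matrix α α ℂ} (hP : P.IsHermitian) (dP : P.det ≠ 0) (W : Matrix α E ℂ) (R : Matrix E E ℂ)
    (hR : (R - Wᴴ * P * W).PosDef) :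
    ∃ h : (Matrix.fromBlocks P (P * W) (Wᴴ * P) R).IsHermitian,
      (Matrix.fromBlocks P (P * W) (Wᴴ * P) R).det ≠ 0 ∧ negCount h = negCount hP := by
  have hRh : R.IsHermitian := by
    have := hR.1.add (jr_herm hP W)
    rwa [sub_add_cancel] at this
  have hN : (Matrix.fromBlocks P (P * W) (Wᴴ * P) R).IsHermitian :=
    Matrix.IsHermitian.fromBlocks hP (by rw [Matrix.conjTranspose_mul, hP.eq]) hRh
  refine ⟨hN, ?_⟩
  obtain ⟨L, hL⟩ := jr_exists_pos hP
  have key : (Matrix.fromBlocks L (-W) 0 (1 : Matrix E E ℂ))ᴴ *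
      (Matrix.fromBlocks P (P * W) (Wᴴ * P) R) * Matrix.fromBlocks L (-W) 0 (1 : Matrix E E ℂ) =
      Matrix.fromBlocks (Lᴴ * P * L) 0 0 (R - Wᴴ * P * W) := by
    rw [Matrix.fromBlocks_conjTranspose, Matrix.fromBlocks_multiply, Matrix.fromBlocks_multiply]
    congr 1
    · simp
    · simp [Matrix.mul_assoc]
    · simp
    · simp [Matrix.mul_assoc]; abel
  have l1 := jr_pos_le hN _ (by rw [key]; exact jr_blk hL hR)
  have l2 := jr_neg_sub hN hP Sum.inl (by ext i j; rfl)
  have l3 := (jr_det hP).1 dP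
  have l4 := jr_count hN
  rw [jr_det hN]
  rw [Fintype.card_sum] at l1 l4 ⊢
  change posCount hP + _ ≤ _ at l1
  omega

theorem jr_glueT {α β σ τ : Type} [Fintype α] [DecidableEq α] [Fintype β] [DecidableEq β]
    [Fintype σ] [DecidableEq σ] [Fintype τ] [DecidableEq τ]
    {P : Matrix α α ℂ} {Q : Matrix β β ℂ} (hP : P.IsHermitian)
    (hQ : Q.IsHermitian) (dP : P.det ≠ 0) (dQ : Q.det ≠ 0) (hle : negCount hQ ≤ negCount hP)
    (f : σ → α) (g : σ → β) (hf : Function.Injective f) (hg : Function.Injective g)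
    (hPQ : P.submatrix f f = Q.submatrix g g) (a : α → τ) (b : β → τ)
    (ha : Function.Injective a) (hb : Function.Injective b) (hab : ∀ s, a (f s) = b (g s))
    (hs : ∀ x y, a x = b y → ∃ s, f s = x ∧ g s = y) (hc : ∀ t, (∃ x, a x = t) ∨ ∃ y, b y = t) :
    ∃ M : Matrix τ τ ℂ, ∃ hM : M.IsHermitian, M.submatrix a a = P ∧ M.submatrix b b = Q ∧
      M.det ≠ 0 ∧ negCount hM = negCount hP := by
  classical
  obtain ⟨W, hW, hD, hpd⟩ := jr_glueW hP hQ dP dQ hle f g hf hg hPQ (fun y => ∀ x, a x ≠ b y)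
    (fun s h => h (f s) (hab s))
  set E := {y : β // ∀ x, a x ≠ b y}
  set WE : Matrix α E ℂ := W.submatrix id Subtype.val with hWE
  obtain ⟨hN, dN, cN⟩ := jr_block hP dP WE (Q.submatrix Subtype.val Subtype.val) (by
    convert hpd using 1
    ext i j
    simp [hWE, Matrix.mul_apply])
  set N := Matrix.fromBlocks P (P * WE) (WEᴴ * P) (Q.submatrix Subtype.val Subtype.val) with hNdef
  have hbij : Function.Bijective (Sum.elim a (fun y : E => b y) : α ⊕ E → τ) := by
    constructor
    · rintro (x | x) (y | y) h
      · exact congrArg _ (ha h)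
      · exact absurd h (y.2 x)
      · exact absurd h.symm (x.2 y)
      · exact congrArg _ (Subtype.ext (hb h))
    · intro t
      rcases hc t with ⟨x, hx⟩ | ⟨y, hy⟩
      · exact ⟨Sum.inl x, hx⟩
      · by_cases h : ∀ x, a x ≠ b y
        · exact ⟨Sum.inr ⟨y, h⟩, hy⟩
        · push Not at h
          obtain ⟨x, hx⟩ := h
          exact ⟨Sum.inl x, hx.trans hy⟩
  set e := (Equiv.ofBijective _ hbij).symm with he
  have ea : ∀ x, e (a x) = Sum.inl x := fun x => by
    rw [he, Equiv.symm_apply_eq]; rfl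
  have eb : ∀ y : E, e (b y) = Sum.inr y := fun x => by
    rw [he, Equiv.symm_apply_eq]; rfl
  have hM : (N.submatrix e e).IsHermitian := hN.submatrix e
  refine ⟨N.submatrix e e, hM, ?_, ?_, ?_, ?_⟩
  · ext i j
    simp [ea, hNdef]
  · have hDH : (Q - Wᴴ * P * W).IsHermitian := hQ.sub (jr_herm hP W)
    have hD' : ∀ s i, (Q - Wᴴ * P * W) (g s) i = 0 := fun s i => by
      rw [← hDH.apply, hD, star_zero]
    have hrow : ∀ s i, Q (g s) i = (P * W) (f s) i := fun s i => by
      have h := hD' s i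
      rw [Matrix.sub_apply, sub_eq_zero] at h
      rw [h, Matrix.mul_assoc, Matrix.mul_apply]
      simp [hW]
    have hcol : ∀ i s, Q i (g s) = (Wᴴ * P) i (f s) := fun i s => by
      have h := hD i s
      rw [Matrix.sub_apply, sub_eq_zero] at h
      rw [h, Matrix.mul_apply]
      simp [hW]
    have hcase : ∀ y, (∀ x, a x ≠ b y) ∨ ∃ s, g s = y := fun y => by
      by_cases h : ∀ x, a x ≠ b y
      · exact Or.inl h
      · push Not at h
        obtain ⟨x, hx⟩ := h
        obtain ⟨s, -, h⟩ := hs x y hx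
        exact Or.inr ⟨s, h⟩
    ext i j
    rw [Matrix.submatrix_apply, Matrix.submatrix_apply]
    rcases hcase i with hi | ⟨s, rfl⟩ <;> rcases hcase j with hj | ⟨s', rfl⟩
    · rw [eb ⟨i, hi⟩, eb ⟨j, hj⟩]; rfl
    · rw [eb ⟨i, hi⟩, ← hab, ea, hcol]; rfl
    · rw [eb ⟨j, hj⟩, ← hab, ea, hrow]; rfl
    · rw [← hab, ← hab, ea, ea]
      exact congrFun (congrFun hPQ s) s'
  · rw [Matrix.det_submatrix_equiv_self]; exact dN
  · rw [← cN]
    refine le_antisymm (jr_neg_sub hN hM e rfl) (jr_neg_sub hM hN e.symm ?_)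
    simp

/-- maximal clique inside `T` -/
def JrMax {n : ℕ} (G : SimpleGraph (Fin n)) (T K : Finset (Fin n)) : Prop :=
  K ⊆ T ∧ G.IsClique (K : Set (Fin n)) ∧
    ∀ K' : Finset (Fin n), K' ⊆ T → G.IsClique (K' : Set (Fin n)) → K ⊆ K' → K' = K

/-- good completion on `T` -/
def JrGood {n : ℕ} (G : SimpleGraph (Fin n)) (A : Matrix (Fin n) (Fin n) ℂ)
    (T : Finset (Fin n)) (M : Matrix T T ℂ) : Prop :=
  ∀ i j : T, (i = j ∨ G.Adj i j) → M i j = A i j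

theorem jr_clique_herm {n : ℕ} (G : SimpleGraph (Fin n)) (A : Matrix (Fin n) (Fin n) ℂ)
    (hA : IsPartialHermitian G A) (K : Finset (Fin n)) (hK : G.IsClique (K : Set (Fin n))) :
    (cliqueSub A K).IsHermitian := by
  ext i j
  rw [Matrix.conjTranspose_apply]
  change star (A j i) = A i j
  by_cases h : i = j
  · subst h
    exact Complex.conj_eq_iff_im.2 (hA.1 i)
  · exact (hA.2 j i (hK j.2 i.2 (fun h' => h (Subtype.ext h'.symm)))).symm

theorem jr_max_mono {n : ℕ} (G : SimpleGraph (Fin n)) (V1 V2 K : Finset (Fin n))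
    (hno : ∀ x ∈ V1, x ∉ V2 → ∀ y ∈ V2, y ∉ V1 → ¬ G.Adj x y)
    (hx : ∃ x ∈ V1, x ∉ V2 ∧ ∀ s ∈ V1 ∩ V2, G.Adj x s) (hK : JrMax G V1 K) :
    JrMax G (V1 ∪ V2) K := by
  obtain ⟨h1, h2, h3⟩ := hK
  refine ⟨h1.trans Finset.subset_union_left, h2, fun K' hT hc hsub => ?_⟩
  by_cases hK' : K' ⊆ V1
  · exact h3 K' hK' hc hsub
  · exfalso
    obtain ⟨y, hy, hy1⟩ := Finset.not_subset.1 hK'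
    have hy2 : y ∈ V2 := by
      have := hT hy
      rw [Finset.mem_union] at this
      tauto
    have hKS : ∀ z ∈ K, z ∈ V1 ∩ V2 := by
      intro z hz
      rw [Finset.mem_inter]
      refine ⟨h1 hz, ?_⟩
      by_contra hz2
      exact hno z (h1 hz) hz2 y hy2 hy1 (hc (hsub hz) hy (fun h => hy1 (h ▸ h1 hz)))
    obtain ⟨x, hx1, hx2, hxs⟩ := hx
    have h4 := h3 (insert x K) (by
      intro z hz
      rcases Finset.mem_insert.1 hz with rfl | hz
      · exact hx1
      · exact h1 hz) (by
      rw [Finset.coe_insert]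
      exact h2.insert (fun b hb _ => hxs b (hKS b hb))) (Finset.subset_insert _ _)
    have : x ∈ K := h4 ▸ Finset.mem_insert_self x K
    exact hx2 (Finset.mem_inter.1 (hKS x this)).2

theorem jr_combine {n : ℕ} (G : SimpleGraph (Fin n)) (A : Matrix (Fin n) (Fin n) ℂ)
    (V1 V2 T : Finset (Fin n)) (hT : V1 ∪ V2 = T)
    (hS : G.IsClique ((V1 ∩ V2 : Finset (Fin n)) : Set (Fin n)))
    (hno : ∀ x ∈ V1, x ∉ V2 → ∀ y ∈ V2, y ∉ V1 → ¬ G.Adj x y)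
    (P : Matrix V1 V1 ℂ) (Q : Matrix V2 V2 ℂ) (hP : P.IsHermitian) (hQ : Q.IsHermitian)
    (gP : JrGood G A V1 P) (gQ : JrGood G A V2 Q) (dP : P.det ≠ 0) (dQ : Q.det ≠ 0)
    (hle : negCount hQ ≤ negCount hP) :
    ∃ M : Matrix T T ℂ, ∃ hM : M.IsHermitian, JrGood G A T M ∧ M.det ≠ 0 ∧
      negCount hM = negCount hP := by
  subst hT
  let f : (V1 ∩ V2 : Finset (Fin n)) → V1 := fun s => ⟨s, (Finset.mem_inter.1 s.2).1⟩
  let g : (V1 ∩ V2 : Finset (Fin n)) → V2 := fun s => ⟨s, (Finset.mem_inter.1 s.2).2⟩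
  let a : V1 → (V1 ∪ V2 : Finset (Fin n)) := fun s => ⟨s, Finset.mem_union_left _ s.2⟩
  let b : V2 → (V1 ∪ V2 : Finset (Fin n)) := fun s => ⟨s, Finset.mem_union_right _ s.2⟩
  obtain ⟨M, hM, ha, hb, dM, cM⟩ := jr_glueT hP hQ dP dQ hle f g
    (fun x y h => Subtype.ext (congrArg (fun z : V1 => (z : Fin n)) h))
    (fun x y h => Subtype.ext (congrArg (fun z : V2 => (z : Fin n)) h))
    (by
      ext i j
      have hij : i = j ∨ G.Adj i j := by
        by_cases h : i = j
        · exact Or.inl h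
        · exact Or.inr (hS i.2 j.2 (fun h' => h (Subtype.ext h')))
      change P (f i) (f j) = Q (g i) (g j)
      rw [gP (f i) (f j) (hij.imp (fun h => by rw [h]) id),
        gQ (g i) (g j) (hij.imp (fun h => by rw [h]) id)])
    a b
    (fun x y h => Subtype.ext (congrArg
      (fun z : (V1 ∪ V2 : Finset (Fin n)) => (z : Fin n)) h))
    (fun x y h => Subtype.ext (congrArg
      (fun z : (V1 ∪ V2 : Finset (Fin n)) => (z : Fin n)) h))
    (fun s => rfl)
    (fun x y h => by
      have h' : (x : Fin n) = y := congrArg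
        (fun z : (V1 ∪ V2 : Finset (Fin n)) => (z : Fin n)) h
      exact ⟨⟨x, Finset.mem_inter.2 ⟨x.2, h' ▸ y.2⟩⟩, rfl, Subtype.ext h'⟩)
    (fun t => by
      rcases Finset.mem_union.1 t.2 with h | h
      · exact Or.inl ⟨⟨t, h⟩, rfl⟩
      · exact Or.inr ⟨⟨t, h⟩, rfl⟩)
  refine ⟨M, hM, ?_, dM, cM⟩
  rintro ⟨i, hi⟩ ⟨j, hj⟩ hij
  have c1 : ∀ (h1 : i ∈ V1) (h2 : j ∈ V1), M ⟨i, hi⟩ ⟨j, hj⟩ = A i j := fun h1 h2 => by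
    rw [← gP ⟨i, h1⟩ ⟨j, h2⟩ (hij.imp (fun h => Subtype.ext (congrArg
      (fun z : (V1 ∪ V2 : Finset (Fin n)) => (z : Fin n)) h)) id), ← ha]
    rfl
  have c2 : ∀ (h1 : i ∈ V2) (h2 : j ∈ V2), M ⟨i, hi⟩ ⟨j, hj⟩ = A i j := fun h1 h2 => by
    rw [← gQ ⟨i, h1⟩ ⟨j, h2⟩ (hij.imp (fun h => Subtype.ext (congrArg
      (fun z : (V1 ∪ V2 : Finset (Fin n)) => (z : Fin n)) h)) id), ← hb]
    rfl
  have hij' : i = j ∨ G.Adj i j := hij.imp (fun h => congrArg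
      (fun z : (V1 ∪ V2 : Finset (Fin n)) => (z : Fin n)) h) id
  rw [Finset.mem_union] at hi hj
  have cases : (i ∈ V1 ∧ j ∈ V1) ∨ (i ∈ V2 ∧ j ∈ V2) := by
    clear c1 c2
    rcases hij' with h | h
    · rw [← h]
      exact hi.imp (fun h => ⟨h, h⟩) (fun h => ⟨h, h⟩)
    · by_contra hcon
      rw [not_or, not_and, not_and] at hcon
      obtain ⟨k1, k2⟩ := hcon
      rcases hi with hi | hi
      · have hj1 := k1 hi
        have hj2 := hj.resolve_left hj1
        exact hno i hi (fun h' => k2 h' hj2) j hj2 hj1 h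
      · have hj1 := k2 hi
        have hj2 := hj.resolve_right hj1
        exact hno j hj2 hj1 i hi (fun h' => k1 h' hj2) h.symm
  rcases cases with ⟨h1, h2⟩ | ⟨h1, h2⟩
  · exact c1 h1 h2
  · exact c2 h1 h2

theorem jr_main {n : ℕ} (G : SimpleGraph (Fin n)) (hG : IsChordal G)
    (A : Matrix (Fin n) (Fin n) ℂ) (hA : IsPartialHermitian G A) (T : Finset (Fin n)) :
    (∀ K, JrMax G T K → (cliqueSub A K).det ≠ 0) →
    ∃ M : Matrix T T ℂ, ∃ hM : M.IsHermitian, JrGood G A T M ∧ M.det ≠ 0 ∧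
      ∃ K, JrMax G T K ∧ ∃ hK : (cliqueSub A K).IsHermitian, negCount hK = negCount hM := by
  induction T using Finset.strongInduction with
  | H T ih =>
    intro hns
    rcases jr_decomp G hG T with hc | ⟨V1, V2, hT, hS, hno, hx1, hx2⟩
    · have hm : JrMax G T T := ⟨subset_rfl, hc, fun K' h1 _ h2 => Finset.Subset.antisymm h1 h2⟩
      exact ⟨cliqueSub A T, jr_clique_herm G A hA T hc, fun i j _ => rfl, hns T hm, T, hm,
        jr_clique_herm G A hA T hc, rfl⟩
    · have m1 : ∀ K, JrMax G V1 K → JrMax G T K := fun K hK => hT ▸ jr_max_mono G V1 V2 K hno hx1 hK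
      have hno' : ∀ x ∈ V2, x ∉ V1 → ∀ y ∈ V1, y ∉ V2 → ¬ G.Adj x y :=
        fun x h1 h2 y h3 h4 h => hno y h3 h4 x h1 h2 h.symm
      have hT' : V2 ∪ V1 = T := by rw [Finset.union_comm, hT]
      have hS' : G.IsClique ((V2 ∩ V1 : Finset (Fin n)) : Set (Fin n)) := by
        rw [Finset.inter_comm]; exact hS
      have m2 : ∀ K, JrMax G V2 K → JrMax G T K := fun K hK => hT' ▸
        jr_max_mono G V2 V1 K hno' (by rw [Finset.inter_comm]; exact hx2) hK
      have s1 : V1 ⊂ T := by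
        obtain ⟨x, h1, h2, -⟩ := hx2
        refine Finset.ssubset_iff_subset_ne.2 ⟨hT ▸ Finset.subset_union_left, fun h => h2 ?_⟩
        rw [h, ← hT]; exact Finset.mem_union_right _ h1
      have s2 : V2 ⊂ T := by
        obtain ⟨x, h1, h2, -⟩ := hx1
        refine Finset.ssubset_iff_subset_ne.2 ⟨hT ▸ Finset.subset_union_right, fun h => h2 ?_⟩
        rw [h, ← hT]; exact Finset.mem_union_left _ h1
      obtain ⟨P, hP, gP, dP, K1, hK1, hh1, e1⟩ := ih V1 s1 (fun K hK => hns K (m1 K hK))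
      obtain ⟨Q, hQ, gQ, dQ, K2, hK2, hh2, e2⟩ := ih V2 s2 (fun K hK => hns K (m2 K hK))
      rcases le_total (negCount hQ) (negCount hP) with hle | hle
      · obtain ⟨M, hM, gM, dM, cM⟩ := jr_combine G A V1 V2 T hT hS hno P Q hP hQ gP gQ dP dQ hle
        exact ⟨M, hM, gM, dM, K1, m1 K1 hK1, hh1, by rw [e1, cM]⟩
      · obtain ⟨M, hM, gM, dM, cM⟩ := jr_combine G A V2 V1 T hT' hS' hno' Q P hQ hP gQ gP dQ dP hle
        exact ⟨M, hM, gM, dM, K2, m2 K2 hK2, hh2, by rw [e2, cM]⟩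


/-- Johnson–Rodman (b): if `G` is chordal, `A` partial Hermitian with graph `G`, and
`A(K)` is nonsingular for every maximal clique `K`, then there is a nonsingular
Hermitian completion `M` with `i₋(M)` equal to the maximum of `i₋(A(K))` over maximal
cliques `K`. -/
theorem stmt8 {n : ℕ} (G : SimpleGraph (Fin n)) (hG : IsChordal G)
    (A : Matrix (Fin n) (Fin n) ℂ) (hA : IsPartialHermitian G A)
    (hns : ∀ K : Finset (Fin n), IsMaxClique G K → (cliqueSub A K).det ≠ 0) :
    ∃ M : Matrix (Fin n) (Fin n) ℂ, ∃ hM : M.IsHermitian,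
      (∀ i j : Fin n, (i = j ∨ G.Adj i j) → M i j = A i j) ∧ M.det ≠ 0 ∧
      IsGreatest {m : ℕ | ∃ K : Finset (Fin n), IsMaxClique G K ∧
          ∃ hK : (cliqueSub A K).IsHermitian, m = negCount hK} (negCount hM) := by
  have hmax : ∀ K, JrMax G Finset.univ K ↔ IsMaxClique G K := fun K =>
    ⟨fun h => ⟨h.2.1, fun K' h1 h2 => h.2.2 K' (Finset.subset_univ _) h1 h2⟩,
      fun h => ⟨Finset.subset_univ _, h.1, fun K' _ h1 h2 => h.2 K' h1 h2⟩⟩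
  obtain ⟨M0, hM0, gM, dM, K, hK, hh, e⟩ := jr_main G hG A hA Finset.univ
    (fun K hK => hns K ((hmax K).1 hK))
  let u : Fin n ≃ (Finset.univ : Finset (Fin n)) :=
    ⟨fun i => ⟨i, Finset.mem_univ i⟩, fun i => i, fun _ => rfl, fun _ => rfl⟩
  have hM : (M0.submatrix u u).IsHermitian := hM0.submatrix u
  have hc : negCount hM = negCount hM0 := by
    refine le_antisymm (jr_neg_sub hM0 hM u rfl) (jr_neg_sub hM hM0 u.symm ?_)
    simp
  have hcompl : ∀ i j : Fin n, (i = j ∨ G.Adj i j) → M0.submatrix u u i j = A i j := by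
    intro i j hij
    exact gM (u i) (u j) (hij.imp (fun h => by rw [h]) id)
  refine ⟨M0.submatrix u u, hM, hcompl, ?_, ?_, ?_⟩
  · rw [Matrix.det_submatrix_equiv_self]; exact dM
  · exact ⟨K, (hmax K).1 hK, hh, by rw [e, hc]⟩
  · rintro m ⟨K', hK', hh', rfl⟩
    refine jr_neg_sub hM hh' (fun i => (i : Fin n)) ?_
    ext i j
    refine hcompl i j ?_
    by_cases h : i = j
    · exact Or.inl (by rw [h])
    · exact Or.inr (hK'.1 i.2 j.2 (fun h' => h (Subtype.ext h')))
end

section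
/- If G is a non-chordal graph, then the completion number of G is at least 1; i.e., there exists a partial positive Hermitian matrix with graph G that admits no positive semidefinite Hermitian completion. -/
open Matrix ComplexOrder

theorem edges_getVert {V : Type*} {G : SimpleGraph V} {u v : V} (w : G.Walk u v) (e : Sym2 V)
    (h : e ∈ w.edges) : ∃ i, i < w.length ∧ e = s(w.getVert i, w.getVert (i + 1)) := by
  induction w with
  | nil => simp at h
  | cons hadj p ih =>
    rw [SimpleGraph.Walk.edges_cons, List.mem_cons] at h
    rcases h with h | h
    · exact ⟨0, by simp, by simpa using h⟩
    · obtain ⟨i, hi, he⟩ := ih h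
      exact ⟨i + 1, by simpa using hi, by simpa using he⟩

/-- The cycle matrix. -/
noncomputable def cycMat {n : ℕ} (C : Set (Fin n)) (e : Sym2 (Fin n)) (t : ℝ) :
    Matrix (Fin n) (Fin n) ℂ := by
  classical
  exact fun i j => if i = j then 1 else if s(i, j) = e then -(t : ℂ) else
    if i ∈ C ∧ j ∈ C then (t : ℂ) else 0

theorem cycMat_symm {n : ℕ} (C : Set (Fin n)) (e : Sym2 (Fin n)) (t : ℝ) (i j : Fin n) :
    cycMat C e t j i = star (cycMat C e t i j) := by
  classical
  simp only [cycMat, Sym2.eq_swap (a := j) (b := i), eq_comm (a := j) (b := i),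
    and_comm (a := j ∈ C)]
  split_ifs <;> simp

theorem cycMat_posDef {n : ℕ} (C : Set (Fin n)) (e : Sym2 (Fin n)) (t : ℝ) (h0 : 0 ≤ t)
    (h1 : t < 1) (he : ∀ x ∈ e, x ∈ C) (K : Finset (Fin n))
    (hK : ∀ x ∈ K, ∀ y ∈ K, ∀ z ∈ K, x ∈ C → y ∈ C → z ∈ C → x = y ∨ x = z ∨ y = z) :
    (cliqueSub (cycMat C e t) K).PosDef := by
  classical
  have hD : ((Matrix.diagonal fun _ => ((1 - t : ℝ) : ℂ)) : Matrix K K ℂ).PosDef := by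
    apply Matrix.PosDef.diagonal
    intro i
    exact_mod_cast sub_pos.2 h1
  have ht : (0 : ℂ) ≤ (t : ℂ) := by exact_mod_cast h0
  have heC : ∀ x y : Fin n, s(x, y) = e → x ∈ C ∧ y ∈ C := by
    rintro x y rfl
    exact ⟨he x (by simp), he y (by simp)⟩
  obtain ⟨u, hu⟩ : ∃ u : K → ℂ, ∀ i j : K, (cycMat C e 1) i j =
      (if i = j ∧ (i : Fin n) ∉ C then 1 else 0) + u i * star (u j) := by
    by_cases ha : ∃ a ∈ K, a ∈ C
    · obtain ⟨a, haK, haC⟩ := ha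
      refine ⟨fun i => if (i : Fin n) ∈ C then cycMat C e 1 i a else 0, ?_⟩
      rintro ⟨i, hi⟩ ⟨j, hj⟩
      have h3 := hK a haK i hi j hj haC
      have q1 := heC i j
      have q2 := heC i a
      have q3 := heC j a
      have q4 := cycMat_symm C e 1 a j
      have q5 : ∀ k : Fin n, cycMat C e 1 k k = 1 := by intro k; simp [cycMat]
      simp only [Subtype.mk.injEq]
      by_cases hiC : i ∈ C
      · by_cases hjC : j ∈ C
        · simp only [hiC, hjC, not_true, and_false, if_false, if_true, zero_add]
          rcases h3 hiC hjC with h | h | h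
          · subst h; rw [q5, ← cycMat_symm, one_mul]
          · subst h; rw [q5, star_one, mul_one]
          · subst h; rw [q5]
            unfold cycMat; split_ifs <;> simp_all
        · have hij : i ≠ j := fun h => hjC (h ▸ hiC)
          have : s(i, j) ≠ e := fun h => hjC (q1 h).2
          simp [cycMat, hij, hiC, hjC, this]
      · have : s(i, j) ≠ e := fun h => hiC (q1 h).1
        by_cases hij : i = j
        · subst hij; simp [cycMat, hiC]
        · simp [cycMat, hij, hiC, this]
    · push Not at ha
      refine ⟨0, ?_⟩
      rintro ⟨i, hi⟩ ⟨j, hj⟩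
      have hiC := ha i hi
      have : s(i, j) ≠ e := fun h => hiC (heC _ _ h).1
      by_cases hij : i = j
      · subst hij; simp [cycMat, hiC]
      · simp [cycMat, hij, hiC, this]
  have hP : ((t : ℂ) • ((Matrix.diagonal fun i : K => if (i : Fin n) ∉ C then (1 : ℂ) else 0) +
      Matrix.vecMulVec u (star u))).PosSemidef := by
    refine Matrix.PosSemidef.smul (Matrix.PosSemidef.add (Matrix.PosSemidef.diagonal ?_)
      (Matrix.posSemidef_vecMulVec_self_star u)) ht
    intro i
    dsimp
    split_ifs <;> simp
  convert hD.add_posSemidef hP using 1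
  ext i j
  have h := hu i j
  simp only [cliqueSub, Matrix.submatrix_apply, Matrix.add_apply, Matrix.smul_apply,
    Matrix.diagonal_apply, Matrix.vecMulVec_apply, Pi.star_apply, smul_eq_mul]
  have h' : (if i = j then (if (i : Fin n) ∉ C then (1 : ℂ) else 0) else 0) + u i * star (u j) =
    cycMat C e 1 i j := by rw [h, ite_and]
  rw [h']
  by_cases hij : i = j
  · subst hij; simp [cycMat]
  · have : (i : Fin n) ≠ j := fun h => hij (Subtype.ext h)
    simp only [cycMat, hij, this, if_false]
    split_ifs <;> simp

theorem no_gram {E : Type*} [NormedAddCommGroup E] [InnerProductSpace ℂ E] (L : ℕ) (hL : 4 ≤ L)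
    (u : ℕ → E) (hn : ∀ i, i < L → ‖u i‖ = 1)
    (h1 : ∀ i, i + 1 < L → RCLike.re (inner ℂ (u i) (u (i + 1))) = 1 - 1 / (L : ℝ) ^ 2)
    (h2 : RCLike.re (inner ℂ (u 0) (u (L - 1))) = -(1 - 1 / (L : ℝ) ^ 2)) : False := by
  have hLp : (0 : ℝ) < L := by exact_mod_cast (by omega : 0 < L)
  set d : ℝ := (3 / 2) / L with hd
  have hdp : 0 < d := by positivity
  have hdd : 2 * (1 / (L : ℝ) ^ 2) ≤ d ^ 2 := by
    rw [hd, div_pow, ← mul_div_assoc]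
    gcongr
    norm_num
  have step : ∀ i, i + 1 < L → ‖u i - u (i + 1)‖ ≤ d := by
    intro i hi
    apply le_of_sq_le_sq _ hdp.le
    rw [@norm_sub_sq ℂ, hn i (by omega), hn _ hi, h1 i hi]
    linarith
  have last : ‖u 0 + u (L - 1)‖ ≤ d := by
    apply le_of_sq_le_sq _ hdp.le
    rw [@norm_add_sq ℂ, hn 0 (by omega), hn _ (by omega), h2]
    linarith
  have tel : ∀ m, m < L → ‖u 0 - u m‖ ≤ m * d := by
    intro m
    induction m with
    | zero => simp
    | succ m ih =>
      intro hm
      have := ih (by omega)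
      have h3 := step m hm
      have h4 := norm_add_le (u 0 - u m) (u m - u (m + 1))
      rw [sub_add_sub_cancel] at h4
      push_cast
      linarith
  have h5 := tel (L - 1) (by omega)
  have h6 := norm_add_le (u 0 - u (L - 1)) (u 0 + u (L - 1))
  have h7 : u 0 - u (L - 1) + (u 0 + u (L - 1)) = (2 : ℂ) • u 0 := by
    rw [two_smul]; abel
  rw [h7, norm_smul, hn 0 (by omega)] at h6
  rw [Nat.cast_sub (by omega)] at h5
  have h8 : (L : ℝ) * d = 3 / 2 := by rw [hd]; field_simp
  norm_num at h6 h5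
  linarith

/-- If `G` is not chordal then there is a partial positive matrix with graph `G`
admitting no positive semidefinite Hermitian completion; hence the completion number
of `G` is at least `1`. -/
theorem stmt10 {n : ℕ} (G : SimpleGraph (Fin n)) (hG : ¬ IsChordal G) :
    ∃ A : Matrix (Fin n) (Fin n) ℂ, IsPartialPositive G A ∧
      ∀ M : Matrix (Fin n) (Fin n) ℂ, M.IsHermitian →
        (∀ i j : Fin n, (i = j ∨ G.Adj i j) → M i j = A i j) → ¬ M.PosSemidef := by
  classical
  unfold IsChordal at hG
  push Not at hG
  obtain ⟨v, w, hw, hlen, hch⟩ := hG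
  set L := w.length with hLdef
  set c := w.getVert with hc
  have hcL : c L = c 0 := by simp [hc, hLdef]
  have hinj : ∀ i j, i < L → j < L → c i = c j → i = j := by
    intro i j hi hj h
    exact hw.getVert_injOn' (by simp; omega) (by simp; omega) h
  set C : Set (Fin n) := {x | x ∈ w.support} with hC
  have hCi : ∀ x ∈ C, ∃ i, i < L ∧ x = c i := by
    intro x hx
    obtain ⟨i, hi, hle⟩ := SimpleGraph.Walk.mem_support_iff_exists_getVert.1 hx
    rcases hle.lt_or_eq with h | h
    · exact ⟨i, h, hi.symm⟩
    · refine ⟨0, by omega, ?_⟩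
      rw [← hcL, ← hi, h]
  have hcC : ∀ i, c i ∈ C := fun i => w.getVert_mem_support i
  have hadj : ∀ i j, i < j → j < L → G.Adj (c i) (c j) → j = i + 1 ∨ (i = 0 ∧ j = L - 1) := by
    intro i j hij hj ha
    have hmem : s(c i, c j) ∈ w.edges := by
      by_contra hne
      exact hch ⟨_, _, hcC i, hcC j, ha, hne⟩
    obtain ⟨k, hk, he⟩ := edges_getVert w _ hmem
    change s(c i, c j) = s(c k, c (k + 1)) at he
    change k < L at hk
    by_cases hk1 : k + 1 < L
    · rw [Sym2.eq_iff] at he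
      rcases he with ⟨h1, h2⟩ | ⟨h1, h2⟩
      · have := hinj _ _ (by omega) hk h1
        have := hinj _ _ hj hk1 h2
        omega
      · have := hinj _ _ (by omega) hk1 h1
        have := hinj _ _ hj hk h2
        omega
    · have hkL : k + 1 = L := by omega
      rw [hkL, hcL, Sym2.eq_iff] at he
      rcases he with ⟨h1, h2⟩ | ⟨h1, h2⟩
      · have := hinj _ _ (by omega) hk h1
        have := hinj _ _ hj (by omega) h2
        omega
      · have := hinj _ _ (by omega) (by omega) h1
        have := hinj _ _ hj hk h2
        omega
  have hLp : (4 : ℝ) ≤ L := by exact_mod_cast hlen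
  have hLi : (0 : ℝ) < 1 / (L : ℝ) ^ 2 := by positivity
  have hLi' : 1 / (L : ℝ) ^ 2 ≤ 1 := by
    rw [div_le_one (by positivity)]
    nlinarith
  refine ⟨cycMat C s(c 0, c (L - 1)) (1 - 1 / (L : ℝ) ^ 2), ⟨⟨?_, ?_⟩, ?_⟩, ?_⟩
  · intro i; simp [cycMat]
  · intro i j _; exact cycMat_symm _ _ _ _ _
  · intro K hK
    apply cycMat_posDef _ _ _ (by linarith) (by linarith)
    · intro x hx
      rw [Sym2.mem_iff] at hx
      rcases hx with rfl | rfl <;> exact hcC _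
    · intro x hx y hy z hz hxC hyC hzC
      by_contra hne
      push Not at hne
      obtain ⟨hxy, hxz, hyz⟩ := hne
      have a1 := hK hx hy hxy
      have a2 := hK hx hz hxz
      have a3 := hK hy hz hyz
      obtain ⟨i, hi, rfl⟩ := hCi x hxC
      obtain ⟨j, hj, rfl⟩ := hCi y hyC
      obtain ⟨k, hk, rfl⟩ := hCi z hzC
      have n1 : i ≠ j := fun h => hxy (h ▸ rfl)
      have n2 : i ≠ k := fun h => hxz (h ▸ rfl)
      have n3 : j ≠ k := fun h => hyz (h ▸ rfl)
      have b1 := hadj i j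
      have b2 := hadj j i
      have b3 := hadj i k
      have b4 := hadj k i
      have b5 := hadj j k
      have b6 := hadj k j
      simp only [a1, a2, a3, a1.symm, a2.symm, a3.symm, hi, hj, hk, forall_const] at b1 b2 b3 b4 b5 b6
      omega
  · intro M _ hM hpsd
    obtain ⟨m, f, hf⟩ := Matrix.posSemidef_iff_eq_sum_vecMulVec.1 hpsd
    let g : Fin n → EuclideanSpace ℂ (Fin m) := fun i => WithLp.toLp 2 (fun k => f k i)
    have hg : ∀ i j, inner ℂ (g i) (g j) = M j i := by
      intro i j
      rw [hf]
      simp [g, PiLp.inner_apply, Matrix.sum_apply, Matrix.vecMulVec_apply]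
    apply no_gram L hlen (fun i => g (c i))
    · intro i _
      have h' : ‖g (c i)‖ ^ 2 = 1 := by
        rw [← @inner_self_eq_norm_sq ℂ, hg, hM _ _ (Or.inl rfl)]
        simp [cycMat]
      exact (pow_eq_one_iff_of_nonneg (norm_nonneg _) two_ne_zero).1 h'
    · intro i hi
      have ha : G.Adj (c i) (c (i + 1)) := w.adj_getVert_succ (by omega)
      have hne : s(c (i + 1), c i) ≠ s(c 0, c (L - 1)) := by
        intro he
        rw [Sym2.eq_iff] at he
        rcases he with ⟨h1, h2⟩ | ⟨h1, h2⟩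
        · have := hinj _ _ hi (by omega) h1
          omega
        · have := hinj _ _ hi (by omega) h1
          have := hinj _ _ (by omega) (by omega) h2
          omega
      rw [hg, hM _ _ (Or.inr ha.symm)]
      simp only [cycMat, ha.symm.ne, hne, hcC, and_self, if_true, if_false]
      exact Complex.ofReal_re _
    · have ha : G.Adj (c (L - 1)) (c 0) := by
        have := w.adj_getVert_succ (i := L - 1) (by omega)
        rw [Nat.sub_add_cancel (by omega)] at this
        rw [← hcL]; exact this
      rw [hg, hM _ _ (Or.inr ha)]
      simp only [cycMat, ha.ne, Sym2.eq_swap (a := c (L - 1)), if_true, if_false]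
      rw [← Complex.ofReal_neg]
      exact Complex.ofReal_re _
end

section
/- Let G₂ be the graph on vertices {1,...,8} whose non-edges are exactly {1,3}, {2,4}, {5,7}, {6,8}. Then every partial positive Hermitian matrix with graph G₂ admits a Hermitian completion M with i₋(M) ≤ 2. -/
open Matrix ComplexOrder

/-- The graph on `{1, …, 8}` (here `Fin 8`, `0`-indexed) whose non-edges are exactly
`{1,3}, {2,4}, {5,7}, {6,8}` (i.e. `{0,2}, {1,3}, {4,6}, {5,7}` in `Fin 8`). -/
def G₂ : SimpleGraph (Fin 8) :=
  (SimpleGraph.fromRel (fun i j =>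
    (i = 0 ∧ j = 2) ∨ (i = 1 ∧ j = 3) ∨ (i = 4 ∧ j = 6) ∨ (i = 5 ∧ j = 7)))ᶜ


lemma solve_exact (a b b11 b12 b21 b22 c11 c12 c21 c22 c e : ℂ)
    (hδ : b11 * b22 - b12 * b21 ≠ 0)
    (hΔ : -c12 * b22 * c21 * b11 + c11 * b12 * c22 * b21 ≠ 0)
    (hV1 : -c * c21 * b11 + c11 * b12 * e ≠ 0)
    (hV2 : -c12 * b22 * e + c22 * b21 * c ≠ 0)
    (hU : (-(c11 * b22 * a + c12 * b12 * b) * c21 * b11 + c11 * b12 * (c21 * b21 * a + c22 * b11 * b))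
      * (-c12 * b22 * (c21 * b21 * a + c22 * b11 * b) + c22 * b21 * (c11 * b22 * a + c12 * b12 * b))
      - a * b * (-c12 * b22 * c21 * b11 + c11 * b12 * c22 * b21) ^ 2 ≠ 0) :
    ∃ d1 d2 d3 d4 n11 n12 n21 n22 : ℂ,
      b11 * n11 + b12 * n21 = d1 ∧ b11 * n12 + b12 * n22 = a ∧
      b21 * n11 + b22 * n21 = b ∧ b21 * n12 + b22 * n22 = d2 ∧
      d3 * n11 + c * n21 = c11 ∧ d3 * n12 + c * n22 = c12 ∧
      e * n11 + d4 * n21 = c21 ∧ e * n12 + d4 * n22 = c22 := by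
  set δ := b11 * b22 - b12 * b21 with hδd
  set Δ := -c12 * b22 * c21 * b11 + c11 * b12 * c22 * b21 with hΔd
  set V1 := -c * c21 * b11 + c11 * b12 * e with hV1d
  set V2 := -c12 * b22 * e + c22 * b21 * c with hV2d
  set U1 := -(c11 * b22 * a + c12 * b12 * b) * c21 * b11 + c11 * b12 * (c21 * b21 * a + c22 * b11 * b) with hU1d
  set U2 := -c12 * b22 * (c21 * b21 * a + c22 * b11 * b) + c22 * b21 * (c11 * b22 * a + c12 * b12 * b) with hU2d
  obtain ⟨t, ht⟩ : ∃ t : ℂ, (V1 * V2) * (t * t) + (U1 * V2 + V1 * U2 - Δ ^ 2) * t + (U1 * U2 - a * b * Δ ^ 2) = 0 := by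
    refine exists_quadratic_eq_zero (mul_ne_zero hV1 hV2) ?_
    obtain ⟨s, hs⟩ := IsAlgClosed.exists_pow_nat_eq (discrim (V1 * V2) (U1 * V2 + V1 * U2 - Δ ^ 2) (U1 * U2 - a * b * Δ ^ 2)) (n := 2) (by norm_num)
    exact ⟨s, by rw [← hs]; ring⟩
  have ht0 : t ≠ 0 := by
    rintro rfl
    apply hU
    simpa using ht
  obtain ⟨d1, h1⟩ : ∃ d1, Δ * d1 = U1 + V1 * t := ⟨(U1 + V1 * t) / Δ, by field_simp⟩
  obtain ⟨d2, h2⟩ : ∃ d2, Δ * d2 = U2 + V2 * t := ⟨(U2 + V2 * t) / Δ, by field_simp⟩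
  have htd : t = d1 * d2 - a * b := by
    have : Δ ^ 2 * (t - (d1 * d2 - a * b)) = 0 := by
      linear_combination (-1) * ht + (-Δ * d2) * h1 + (- (U1 + V1 * t)) * h2
    rcases mul_eq_zero.1 this with h | h
    · exact absurd h (pow_ne_zero 2 hΔ)
    · exact sub_eq_zero.1 h
  have e1 : c11 * (b22 * a - b12 * d2) - c12 * (b22 * d1 - b12 * b) = - c * t := by
    apply mul_left_cancel₀ hΔ
    linear_combination (-c11 * b12) * h2 + (-c12 * b22) * h1
  have e2 : c21 * (-b21 * a + b11 * d2) - c22 * (-b21 * d1 + b11 * b) = e * t := by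
    apply mul_left_cancel₀ hΔ
    linear_combination (c21 * b11) * h2 + (c22 * b21) * h1
  clear_value δ Δ V1 V2 U1 U2
  refine ⟨d1, d2, (c11 * (-b21 * a + b11 * d2) - c12 * (-b21 * d1 + b11 * b)) / t,
    (-c21 * (b22 * a - b12 * d2) + c22 * (b22 * d1 - b12 * b)) / t,
    (b22 * d1 - b12 * b) / δ, (b22 * a - b12 * d2) / δ, (-b21 * d1 + b11 * b) / δ,
    (-b21 * a + b11 * d2) / δ, ?_, ?_, ?_, ?_, ?_, ?_, ?_, ?_⟩
  · field_simp; rw [hδd]; ring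
  · field_simp; rw [hδd]; ring
  · field_simp; rw [hδd]; ring
  · field_simp; rw [hδd]; ring
  · field_simp; rw [hδd]
    linear_combination (-b21 * d1 + b11 * b) * e1 - c11 * (b11 * b22 - b12 * b21) * htd
  · field_simp; rw [hδd]
    linear_combination (-b21 * a + b11 * d2) * e1 - c12 * (b11 * b22 - b12 * b21) * htd
  · field_simp; rw [hδd]
    linear_combination (-(b22 * d1 - b12 * b)) * e2 - c21 * (b11 * b22 - b12 * b21) * htd
  · field_simp; rw [hδd]
    linear_combination (-(b22 * a - b12 * d2)) * e2 - c22 * (b11 * b22 - b12 * b21) * htd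

lemma ev_ne (f : ℂ → ℂ) (hf : Differentiable ℂ f) (h1 : f 1 ≠ 0) :
    ∀ᶠ s in nhdsWithin (0:ℂ) {0}ᶜ, f s ≠ 0 := by
  by_contra h
  have h2 : ∃ᶠ s in nhdsWithin (0:ℂ) {0}ᶜ, f s = 0 := by
    exact (Filter.not_eventually.1 h).mono fun s hs => not_not.1 hs
  have ha : AnalyticOnNhd ℂ f Set.univ := fun x _ => hf.analyticAt x
  exact h1 (ha.eqOn_zero_of_preconnected_of_frequently_eq_zero isPreconnected_univ
    (Set.mem_univ 0) h2 (Set.mem_univ 1))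

lemma approx (X : Matrix (Fin 4) (Fin 4) ℂ) (ε : ℝ) (hε : 0 < ε) :
    ∃ (U : Matrix (Fin 4) (Fin 2) ℂ) (V : Matrix (Fin 2) (Fin 4) ℂ),
      ∀ i j, i ≠ j → ‖X i j - (U * V) i j‖ ≤ ε := by
  let Z : Matrix (Fin 4) (Fin 4) ℂ := !![0, 0, 1, 1; 1, 0, 1, 2; 1, 2, 0, 1; 1, 1, 2, 0]
  let Y : ℂ → Matrix (Fin 4) (Fin 4) ℂ := fun s => fun i j => X i j + s * (Z i j - X i j)
  have hYd : ∀ i j, Differentiable ℂ (fun s => Y s i j) := by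
    intro i j; simp only [Y]; fun_prop
  have hY1 : ∀ i j, Y 1 i j = Z i j := by intro i j; simp [Y]
  have hsm : ∀ᶠ s in nhdsWithin (0:ℂ) {0}ᶜ, ∀ i j, ‖X i j - Y s i j‖ ≤ ε := by
    rw [Filter.eventually_all]; intro i
    rw [Filter.eventually_all]; intro j
    apply Filter.Eventually.filter_mono nhdsWithin_le_nhds
    have : ContinuousAt (fun s => ‖X i j - Y s i j‖) 0 :=
      (continuous_const.sub (hYd i j).continuous).norm.continuousAt
    have h0 : (fun s => ‖X i j - Y s i j‖) 0 < ε := by simpa [Y] using hε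
    exact (this.eventually_lt_const h0).mono fun s hs => le_of_lt hs
  have k1 := ev_ne (fun s => Y s 0 2 * Y s 1 3 - Y s 0 3 * Y s 1 2) (by fun_prop)
    (by simp only [hY1]; simp [Z]; try norm_num)
  have k2 := ev_ne (fun s => -Y s 2 1 * Y s 1 3 * Y s 3 0 * Y s 0 2 + Y s 2 0 * Y s 0 3 * Y s 3 1 * Y s 1 2)
    (by fun_prop) (by simp only [hY1]; simp [Z]; try norm_num)
  have k3 := ev_ne (fun s => -Y s 2 3 * Y s 3 0 * Y s 0 2 + Y s 2 0 * Y s 0 3 * Y s 3 2)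
    (by fun_prop) (by simp only [hY1]; simp [Z]; try norm_num)
  have k4 := ev_ne (fun s => -Y s 2 1 * Y s 1 3 * Y s 3 2 + Y s 3 1 * Y s 1 2 * Y s 2 3)
    (by fun_prop) (by simp only [hY1]; simp [Z]; try norm_num)
  have k5 := ev_ne (fun s => (-(Y s 2 0 * Y s 1 3 * Y s 0 1 + Y s 2 1 * Y s 0 3 * Y s 1 0) * Y s 3 0 * Y s 0 2 + Y s 2 0 * Y s 0 3 * (Y s 3 0 * Y s 1 2 * Y s 0 1 + Y s 3 1 * Y s 0 2 * Y s 1 0))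
      * (-Y s 2 1 * Y s 1 3 * (Y s 3 0 * Y s 1 2 * Y s 0 1 + Y s 3 1 * Y s 0 2 * Y s 1 0) + Y s 3 1 * Y s 1 2 * (Y s 2 0 * Y s 1 3 * Y s 0 1 + Y s 2 1 * Y s 0 3 * Y s 1 0))
      - Y s 0 1 * Y s 1 0 * (-Y s 2 1 * Y s 1 3 * Y s 3 0 * Y s 0 2 + Y s 2 0 * Y s 0 3 * Y s 3 1 * Y s 1 2) ^ 2)
    (by fun_prop) (by simp only [hY1]; simp [Z]; try norm_num)
  obtain ⟨s, g0, g1, g2, g3, g4, g5⟩ := (hsm.and (k1.and (k2.and (k3.and (k4.and k5))))).exists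
  obtain ⟨d1, d2, d3, d4, n11, n12, n21, n22, r1, r2, r3, r4, r5, r6, r7, r8⟩ :=
    solve_exact (Y s 0 1) (Y s 1 0) (Y s 0 2) (Y s 0 3) (Y s 1 2) (Y s 1 3)
      (Y s 2 0) (Y s 2 1) (Y s 3 0) (Y s 3 1) (Y s 2 3) (Y s 3 2) g1 g2 g3 g4 g5
  refine ⟨!![Y s 0 2, Y s 0 3; Y s 1 2, Y s 1 3; d3, Y s 2 3; Y s 3 2, d4],
    !![n11, n12, 1, 0; n21, n22, 0, 1], ?_⟩
  intro i j hij
  have : (!![Y s 0 2, Y s 0 3; Y s 1 2, Y s 1 3; d3, Y s 2 3; Y s 3 2, d4] *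
    !![n11, n12, 1, 0; n21, n22, 0, 1] : Matrix (Fin 4) (Fin 4) ℂ) i j = Y s i j := by
    fin_cases i <;> fin_cases j <;>
      first
      | exact absurd rfl hij
      | simpa [Matrix.mul_apply, Fin.sum_univ_two] using ‹_›
  rw [this]; exact g0 i j

lemma negCount_le {n : Type*} [Fintype n] [DecidableEq n] {M : Matrix n n ℂ} (hM : M.IsHermitian)
    (L : (n → ℂ) →ₗ[ℂ] (Fin 2 → ℂ))
    (h : ∀ v, L v = 0 → 0 ≤ (star v ⬝ᵥ (M *ᵥ v)).re) : negCount hM ≤ 2 := by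
  by_contra hlt
  push Not at hlt
  unfold negCount at hlt
  let b : {i // hM.eigenvalues i < 0} → n → ℂ := fun i => ⇑(hM.eigenvectorBasis i)
  let T : ({i // hM.eigenvalues i < 0} → ℂ) →ₗ[ℂ] (n → ℂ) := Fintype.linearCombination ℂ b
  have hk := LinearMap.ker_ne_bot_of_finrank_lt (f := L.comp T) (by simpa using hlt)
  obtain ⟨c, hc, hc0⟩ := Submodule.exists_mem_ne_zero_of_ne_bot hk
  have hc' : L (T c) = 0 := hc
  have h1 := h _ hc'
  have hT : T c = ∑ i, c i • b i := by simp [T, Fintype.linearCombination_apply]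
  have horth : ∀ i j, star (b i) ⬝ᵥ b j = if i = j then 1 else 0 := by
    intro i j
    have := orthonormal_iff_ite.1 hM.eigenvectorBasis.orthonormal i.1 j.1
    rw [EuclideanSpace.inner_eq_star_dotProduct, dotProduct_comm] at this
    simpa [Subtype.ext_iff] using this
  have hMT : M *ᵥ (T c) = ∑ i, (c i * hM.eigenvalues i) • b i := by
    rw [hT, Matrix.mulVec_sum]
    refine Finset.sum_congr rfl fun i _ => ?_
    rw [Matrix.mulVec_smul]
    have := hM.mulVec_eigenvectorBasis i.1
    simp only [b]
    rw [this, mul_smul]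
    congr 1
  have hq : (star (T c) ⬝ᵥ (M *ᵥ (T c))) = ∑ i, ((hM.eigenvalues i.1 * ‖c i‖ ^ 2 : ℝ) : ℂ) := by
    rw [hMT, hT, star_sum, sum_dotProduct]
    refine Finset.sum_congr rfl fun i _ => ?_
    rw [dotProduct_sum, Finset.sum_eq_single i]
    · rw [star_smul, smul_dotProduct, dotProduct_smul, horth]
      simp only [if_true, smul_eq_mul]
      have := Complex.conj_mul' (c i)
      push_cast
      rw [← this]
      simp; ring
    · intro j _ hj
      rw [star_smul, smul_dotProduct, dotProduct_smul, horth, if_neg (Ne.symm hj)]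
      simp
    · simp
  rw [hq, Complex.re_sum] at h1
  simp only [Complex.ofReal_re] at h1
  obtain ⟨i, hi⟩ := Function.ne_iff.1 hc0
  have : ∑ i : {i // hM.eigenvalues i < 0}, hM.eigenvalues i.1 * ‖c i‖ ^ 2 < 0 := by
    apply Finset.sum_neg' 
    · intro j _
      exact mul_nonpos_of_nonpos_of_nonneg j.2.le (by positivity)
    · refine ⟨i, Finset.mem_univ _, mul_neg_of_neg_of_pos i.2 ?_⟩
      have : 0 < ‖c i‖ := norm_pos_iff.2 hi
      positivity
  linarith

lemma posDef_lower {P : Matrix (Fin 4) (Fin 4) ℂ} (hP : P.PosDef) :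
    ∃ c : ℝ, 0 < c ∧ ∀ x : Fin 4 → ℂ, c * ‖x‖ ^ 2 ≤ (star x ⬝ᵥ (P *ᵥ x)).re := by
  let f : (Fin 4 → ℂ) → ℝ := fun x => (star x ⬝ᵥ (P *ᵥ x)).re
  have hf : Continuous f := by
    simp only [f, dotProduct, Matrix.mulVec, Pi.star_apply]
    fun_prop
  have hne : (Metric.sphere (0 : Fin 4 → ℂ) 1).Nonempty := NormedSpace.sphere_nonempty.2 zero_le_one
  obtain ⟨x0, hx0, hmin⟩ := (isCompact_sphere (0 : Fin 4 → ℂ) 1).exists_isMinOn hne hf.continuousOn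
  have hx0n : ‖x0‖ = 1 := by simpa using hx0
  refine ⟨f x0, ?_, ?_⟩
  · exact hP.re_dotProduct_pos (x := x0) (by rintro rfl; simp at hx0n)
  · intro x
    by_cases hx : x = 0
    · subst hx; simp
    have hxn : 0 < ‖x‖ := norm_pos_iff.2 hx
    have h1 : f x0 ≤ f (((‖x‖⁻¹ : ℝ) : ℂ) • x) := by
      apply hmin
      simp [norm_smul, hxn.ne']
    have h2 : f (((‖x‖⁻¹ : ℝ) : ℂ) • x) = ‖x‖⁻¹ ^ 2 * f x := by
      simp only [f]
      rw [star_smul, Matrix.mulVec_smul, smul_dotProduct, dotProduct_smul, smul_smul,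
        show star ((‖x‖⁻¹ : ℝ) : ℂ) * ((‖x‖⁻¹ : ℝ) : ℂ) = ((‖x‖⁻¹ ^ 2 : ℝ) : ℂ) by
          rw [Complex.star_def, Complex.conj_ofReal]; push_cast; ring, smul_eq_mul,
        Complex.re_ofReal_mul]
    rw [h2] at h1
    calc f x0 * ‖x‖ ^ 2 ≤ ‖x‖⁻¹ ^ 2 * f x * ‖x‖ ^ 2 := by gcongr
      _ = f x := by field_simp

lemma cross_bound (E : Matrix (Fin 4) (Fin 4) ℂ) (ε : ℝ) (hE : ∀ i j, ‖E i j‖ ≤ ε)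
    (x y : Fin 4 → ℂ) : ‖star x ⬝ᵥ (E *ᵥ y)‖ ≤ 16 * ε * (‖x‖ * ‖y‖) := by
  have h0 : 0 ≤ ε := (norm_nonneg _).trans (hE 0 0)
  simp only [dotProduct, Matrix.mulVec, Pi.star_apply]
  calc _ ≤ ∑ i : Fin 4, ‖star (x i) * ∑ j, E i j * y j‖ := norm_sum_le _ _
    _ ≤ ∑ i : Fin 4, ‖x‖ * ∑ j : Fin 4, ε * ‖y‖ := by
      refine Finset.sum_le_sum fun i _ => ?_
      rw [norm_mul, norm_star]
      refine mul_le_mul (norm_le_pi_norm x i) ?_ (norm_nonneg _) (norm_nonneg _)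
      refine (norm_sum_le _ _).trans (Finset.sum_le_sum fun j _ => ?_)
      rw [norm_mul]
      exact mul_le_mul (hE i j) (norm_le_pi_norm y j) (norm_nonneg _) h0
    _ = _ := by simp; ring

def idx : Fin 4 ⊕ Fin 4 → Fin 8 := Sum.elim ![0, 1, 4, 5] ![2, 3, 6, 7]

lemma idx_bij : Function.Bijective idx := by
  unfold idx
  decide

lemma G2_adj (i j : Fin 8) : G₂.Adj i j ↔ i ≠ j ∧
    ¬ (((i = 0 ∧ j = 2) ∨ (i = 1 ∧ j = 3) ∨ (i = 4 ∧ j = 6) ∨ (i = 5 ∧ j = 7)) ∨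
      ((j = 0 ∧ i = 2) ∨ (j = 1 ∧ i = 3) ∨ (j = 4 ∧ i = 6) ∨ (j = 5 ∧ i = 7))) := by
  simp only [G₂, SimpleGraph.compl_adj, SimpleGraph.fromRel_adj]
  exact ⟨fun h => ⟨h.1, fun r => h.2 ⟨h.1, r⟩⟩, fun h => ⟨h.1, fun r => h.2 r.2⟩⟩

lemma adj_ll (i j : Fin 4) (h : i ≠ j) : G₂.Adj (idx (.inl i)) (idx (.inl j)) := by
  rw [G2_adj]; revert i j; unfold idx; decide

lemma adj_rr (i j : Fin 4) (h : i ≠ j) : G₂.Adj (idx (.inr i)) (idx (.inr j)) := by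
  rw [G2_adj]; revert i j; unfold idx; decide

lemma adj_lr (i j : Fin 4) : G₂.Adj (idx (.inl i)) (idx (.inr j)) ↔ i ≠ j := by
  rw [G2_adj]; revert i j; unfold idx; decide

lemma posDef_of_clique (A : Matrix (Fin 8) (Fin 8) ℂ) (hA : IsPartialPositive G₂ A)
    (f : Fin 4 → Fin 8) (hf : Function.Injective f) (h : ∀ i j, i ≠ j → G₂.Adj (f i) (f j)) :
    (A.submatrix f f).PosDef := by
  have h1 := hA.2 (Finset.univ.image f) (by
    intro a ha b hb hab
    simp only [Finset.coe_image, Finset.coe_univ, Set.image_univ, Set.mem_range] at ha hb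
    obtain ⟨i, rfl⟩ := ha
    obtain ⟨j, rfl⟩ := hb
    exact h i j (fun e => hab (by rw [e])))
  exact h1.submatrix (e := fun i => ⟨f i, by simp⟩) (fun i j hij => hf (by simpa using hij))

/-- Every partial positive matrix with graph `G₂` admits a Hermitian completion with
at most two negative eigenvalues. -/
theorem stmt12 (A : Matrix (Fin 8) (Fin 8) ℂ) (hA : IsPartialPositive G₂ A) :
    ∃ M : Matrix (Fin 8) (Fin 8) ℂ, ∃ hM : M.IsHermitian,
      (∀ i j : Fin 8, (i = j ∨ G₂.Adj i j) → M i j = A i j) ∧ negCount hM ≤ 2 := by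
  let e : Fin 4 ⊕ Fin 4 ≃ Fin 8 := Equiv.ofBijective idx idx_bij
  have he : ∀ a, e a = idx a := fun a => rfl
  let P : Matrix (Fin 4) (Fin 4) ℂ := A.submatrix (fun i => idx (.inl i)) (fun i => idx (.inl i))
  let Q : Matrix (Fin 4) (Fin 4) ℂ := A.submatrix (fun i => idx (.inr i)) (fun i => idx (.inr i))
  have hP : P.PosDef := posDef_of_clique A hA _
    (fun i j h => Sum.inl_injective (idx_bij.1 h)) adj_ll
  have hQ : Q.PosDef := posDef_of_clique A hA _
    (fun i j h => Sum.inr_injective (idx_bij.1 h)) adj_rr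
  obtain ⟨p, hp, hpP⟩ := posDef_lower hP
  obtain ⟨q, hq, hqQ⟩ := posDef_lower hQ
  obtain ⟨ε, hε, hεp, hεq⟩ : ∃ ε : ℝ, 0 < ε ∧ 16 * ε ≤ p ∧ 16 * ε ≤ q :=
    ⟨min p q / 16, by positivity, by linarith [min_le_left p q], by linarith [min_le_right p q]⟩
  obtain ⟨U, V, hUV⟩ := approx
    (A.submatrix (fun i => idx (.inl i)) (fun i => idx (.inr i))) ε hε
  let X : Matrix (Fin 4) (Fin 4) ℂ := Matrix.of fun i j =>
    if i = j then (U * V) i j else A (idx (.inl i)) (idx (.inr j))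
  have hE : ∀ i j, ‖(X - U * V) i j‖ ≤ ε := by
    intro i j
    by_cases hij : i = j
    · simp [X, hij, hε.le]
    · simpa [X, hij] using hUV i j hij
  let N : Matrix (Fin 4 ⊕ Fin 4) (Fin 4 ⊕ Fin 4) ℂ := Matrix.fromBlocks P X Xᴴ Q
  have hN : N.IsHermitian := Matrix.IsHermitian.fromBlocks hP.1 rfl hQ.1
  have hM : (N.submatrix e.symm e.symm).IsHermitian := hN.submatrix _
  refine ⟨N.submatrix e.symm e.symm, hM, ?_, ?_⟩
  · intro i j hij
    obtain ⟨a, rfl⟩ := e.surjective i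
    obtain ⟨b, rfl⟩ := e.surjective j
    simp only [Matrix.submatrix_apply, Equiv.symm_apply_apply]
    simp only [he] at hij ⊢
    rcases a with a | a <;> rcases b with b | b
    · rfl
    · have hab : a ≠ b := by
        rcases hij with h | h
        · exact absurd (idx_bij.1 h) (by simp)
        · exact (adj_lr a b).1 h
      simp [N, X, hab]
    · have hadj : G₂.Adj (idx (.inl b)) (idx (.inr a)) := by
        rcases hij with h | h
        · exact absurd (idx_bij.1 h) (by simp)
        · exact h.symm
      have hab : b ≠ a := (adj_lr b a).1 hadj
      have := hA.1.2 _ _ hadj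
      simp [N, X, hab, this]
    · rfl
  · refine negCount_le hM (V.mulVecLin.comp
      (LinearMap.funLeft ℂ ℂ (fun i : Fin 4 => e (.inr i)))) ?_
    intro v hv
    set x : Fin 4 → ℂ := fun i => v (e (.inl i)) with hx
    set y : Fin 4 → ℂ := fun i => v (e (.inr i)) with hy
    have hVy : V *ᵥ y = 0 := hv
    have hvv : v = (Sum.elim x y) ∘ e.symm := by
      funext i
      obtain ⟨a, rfl⟩ := e.surjective i
      rcases a with a | a <;> simp [hx, hy]
    have hform : star v ⬝ᵥ (N.submatrix e.symm e.symm *ᵥ v) =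
        star x ⬝ᵥ (P *ᵥ x) + star x ⬝ᵥ (X *ᵥ y) + (star y ⬝ᵥ (Xᴴ *ᵥ x) + star y ⬝ᵥ (Q *ᵥ y)) := by
      have h1 : N.submatrix e.symm e.symm *ᵥ v = (N *ᵥ Sum.elim x y) ∘ e.symm := by
        rw [Matrix.submatrix_mulVec_equiv]
        congr 2
        rw [hvv]; funext a; simp
      have h2 : star v = (Sum.elim (star x) (star y)) ∘ e.symm := by
        rw [hvv]; funext i
        obtain ⟨a, rfl⟩ := e.surjective i
        rcases a with a | a <;> simp
      rw [h1, h2, comp_equiv_dotProduct_comp_equiv]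
      simp only [N, Matrix.fromBlocks_mulVec, Sum.elim_comp_inl, Sum.elim_comp_inr,
        sumElim_dotProduct_sumElim, dotProduct_add]
    have hXy : X *ᵥ y = (X - U * V) *ᵥ y := by
      rw [Matrix.sub_mulVec, ← Matrix.mulVec_mulVec, hVy]; simp
    have hconj : (star y ⬝ᵥ (Xᴴ *ᵥ x)).re = (star x ⬝ᵥ (X *ᵥ y)).re := by
      have : star y ⬝ᵥ (Xᴴ *ᵥ x) = star (star x ⬝ᵥ (X *ᵥ y)) := by
        rw [Matrix.star_dotProduct, Matrix.star_mulVec, Matrix.conjTranspose_conjTranspose,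
          dotProduct_mulVec]
      rw [this]; simp
    have hb := cross_bound _ ε hE x y
    rw [← hXy] at hb
    have hre := (abs_le.1 ((Complex.abs_re_le_norm _).trans hb)).1
    rw [hform]
    simp only [Complex.add_re, hconj]
    have h1 := hpP x
    have h2 := hqQ y
    nlinarith [mul_le_mul_of_nonneg_right hεp (sq_nonneg ‖x‖),
      mul_le_mul_of_nonneg_right hεq (sq_nonneg ‖y‖),
      mul_nonneg hε.le (sq_nonneg (‖x‖ - ‖y‖))]
end
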